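/- arXiv:1604.04123 — 11 statements merged into one kernel-verified Lean document; each statement's English description precedes it below -/
import Mathlib

section
/- Let n, m ≥ 2 be even integers, (w,l) ∈ L⁺₀(n), (w',l') ∈ L⁺₀(m), and set κ' := (w+w')/2, κ := κ' + 1/2 and L := (1/2)·min{|l_i − l'_j| : 1 ≤ i ≤ n, 1 ≤ j ≤ m}. Then for every t ∈ (n+m)/2 + ℤ the following are equivalent: (a) for all 1 ≤ i ≤ n/2 and 1 ≤ j ≤ m/2 one has t − κ' + (l_i + l'_j)/2 ∉ ℤ≤0 and 1 − t + κ' + (l_i + l'_j)/2 ∉ ℤ≤0; if l_i ≠ l'_j, also t − κ' + |l_i − l'_j|/2 ∉ ℤ≤0 and 1 − t + κ' + |l_i − l'_j|/2 ∉ ℤ≤0; and if l_i = l'_j, none of t − κ', t − κ' + 1, 1 − t + κ', 2 − t + κ' lies in 2ℤ≤0; (b) |t − κ| < L + 1/2. -/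
/-- `x ∈ ℤ≤0 = {0, -1, -2, ...}`, the pole set of `Γ_ℂ`. -/
def InZle0 (x : ℚ) : Prop := ∃ z : ℤ, z ≤ 0 ∧ x = z

/-- `x ∈ 2ℤ≤0 = {0, -2, -4, ...}`, the pole set of `Γ_ℝ`. -/
def In2Zle0 (x : ℚ) : Prop := ∃ z : ℤ, z ≤ 0 ∧ x = 2 * z

/-- `(w, l) ∈ L⁺₀(n)`: `l₁ > l₂ > … > l_n`, `l_i + l_{n+1-i} = 0`,
`w + l_i ≡ n + 1 (mod 2)` (indices `1,…,n`). -/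
def IsLanglandsParam (n : ℕ) (w : ℤ) (l : ℕ → ℤ) : Prop :=
  (∀ i, 1 ≤ i → i < n → l (i + 1) < l i) ∧
  (∀ i, 1 ≤ i → i ≤ n → l i + l (n + 1 - i) = 0) ∧
  (∀ i, 1 ≤ i → i ≤ n → (w + l i) % 2 = ((n : ℤ) + 1) % 2)

theorem zle0_iff (x : ℚ) (X : ℤ) (hx : x = (X : ℚ) / 2) (hX : X % 2 = 0) :
    InZle0 x ↔ X ≤ 0 := by
  obtain ⟨k, hk⟩ : ∃ k, X = 2 * k := ⟨X / 2, by omega⟩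
  have hxk : x = (k : ℚ) := by rw [hx, hk]; push_cast; ring
  constructor
  · rintro ⟨z, hz, h⟩
    have : k = z := by rw [hxk] at h; exact_mod_cast h
    omega
  · intro h
    exact ⟨k, by omega, hxk⟩

theorem two_zle0_iff (x : ℚ) (X : ℤ) (hx : x = (X : ℚ) / 2) (hX : X % 2 = 0) :
    In2Zle0 x ↔ X ≤ 0 ∧ X % 4 = 0 := by
  obtain ⟨k, hk⟩ : ∃ k, X = 2 * k := ⟨X / 2, by omega⟩
  have hxk : x = (k : ℚ) := by rw [hx, hk]; push_cast; ring
  constructor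
  · rintro ⟨z, hz, h⟩
    have : k = 2 * z := by rw [hxk] at h; exact_mod_cast h
    omega
  · rintro ⟨h, h4⟩
    refine ⟨k / 2, by omega, ?_⟩
    have : k = 2 * (k / 2) := by omega
    rw [hxk]
    exact_mod_cast this

theorem anti_aux (n : ℕ) (l : ℕ → ℤ)
    (h : ∀ i, 1 ≤ i → i < n → l (i + 1) < l i) (i : ℕ) (hi : 1 ≤ i) :
    ∀ d, 1 ≤ d → i + d ≤ n → l (i + d) < l i := by
  intro d
  induction d with
  | zero => intro h0; omega
  | succ d ih =>
    intro _ hd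
    have h1 := h (i + d) (by omega) (by omega)
    rcases Nat.eq_zero_or_pos d with h0 | h0
    · subst h0; simpa using h1
    · have := ih h0 (by omega)
      have e : i + (d + 1) = i + d + 1 := by ring
      rw [e]; omega

theorem pos_aux (n : ℕ) (w : ℤ) (l : ℕ → ℤ) (hl : IsLanglandsParam n w l) (hne : Even n)
    (i : ℕ) (hi : 1 ≤ i) (hi2 : i ≤ n / 2) : 0 < l i := by
  obtain ⟨k, hk⟩ := hne
  have h1 := anti_aux n l hl.1 i hi (n + 1 - i - i) (by omega) (by omega)
  have h2 := hl.2.1 i hi (by omega)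
  have e : i + (n + 1 - i - i) = n + 1 - i := by omega
  rw [e] at h1
  omega

theorem half_aux (n : ℕ) (w : ℤ) (l : ℕ → ℤ) (hl : IsLanglandsParam n w l) (hne : Even n)
    (i : ℕ) (hi : 1 ≤ i) (hi2 : i ≤ n) :
    ∃ i₀, 1 ≤ i₀ ∧ i₀ ≤ n / 2 ∧ 0 < l i₀ ∧ (l i = l i₀ ∨ l i = - l i₀) := by
  have hne' := hne
  obtain ⟨k, hk⟩ := hne'
  by_cases h : i ≤ n / 2
  · exact ⟨i, hi, h, pos_aux n w l hl hne i hi h, Or.inl rfl⟩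
  · refine ⟨n + 1 - i, by omega, by omega, pos_aux n w l hl hne _ (by omega) (by omega), ?_⟩
    have := hl.2.1 i hi hi2
    omega

theorem criticality_criterion_even_even
    (n m : ℕ) (hn : 2 ≤ n) (hm : 2 ≤ m) (hne : Even n) (hme : Even m)
    (w w' : ℤ) (l l' : ℕ → ℤ)
    (hl : IsLanglandsParam n w l) (hl' : IsLanglandsParam m w' l')
    (κ' κ L : ℚ) (hκ' : κ' = ((w : ℚ) + w') / 2) (hκ : κ = κ' + 1 / 2)
    -- `L` is half the minimum of `|l_i - l'_j|` over all `1 ≤ i ≤ n`, `1 ≤ j ≤ m`: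
    (hLlb : ∀ i ∈ Finset.Icc 1 n, ∀ j ∈ Finset.Icc 1 m, L ≤ (|l i - l' j| : ℚ) / 2)
    (hLmem : ∃ i ∈ Finset.Icc 1 n, ∃ j ∈ Finset.Icc 1 m, L = (|l i - l' j| : ℚ) / 2)
    (t : ℚ) (ht : ∃ z : ℤ, t = ((n : ℚ) + m) / 2 + z) :
    (∀ i ∈ Finset.Icc 1 (n / 2), ∀ j ∈ Finset.Icc 1 (m / 2),
      (¬ InZle0 (t - κ' + ((l i : ℚ) + l' j) / 2) ∧
        ¬ InZle0 (1 - t + κ' + ((l i : ℚ) + l' j) / 2)) ∧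
      (l i ≠ l' j →
        ¬ InZle0 (t - κ' + (|l i - l' j| : ℚ) / 2) ∧
        ¬ InZle0 (1 - t + κ' + (|l i - l' j| : ℚ) / 2)) ∧
      (l i = l' j →
        ¬ In2Zle0 (t - κ') ∧ ¬ In2Zle0 (t - κ' + 1) ∧
        ¬ In2Zle0 (1 - t + κ') ∧ ¬ In2Zle0 (2 - t + κ'))) ↔
    |t - κ| < L + 1 / 2 := by
  obtain ⟨z, hz⟩ := ht
  obtain ⟨p, hp⟩ := id hne
  obtain ⟨q, hq⟩ := id hme
  obtain ⟨i₁, hi₁, j₁, hj₁, hL⟩ := hLmem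
  rw [Finset.mem_Icc] at hi₁ hj₁
  obtain ⟨S, hSd⟩ : ∃ S : ℤ, S = 2 * (p + q + z) - w - w' := ⟨_, rfl⟩
  have hS : t - κ' = (S : ℚ) / 2 := by
    rw [hz, hκ', hSd, hp, hq]; push_cast; ring
  obtain ⟨M, hMd⟩ : ∃ M : ℤ, M = |l i₁ - l' j₁| := ⟨_, rfl⟩
  have hM : L = (M : ℚ) / 2 := by rw [hL, hMd]; push_cast; ring
  have hlb : ∀ i, 1 ≤ i → i ≤ n → ∀ j, 1 ≤ j → j ≤ m → M ≤ |l i - l' j| := by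
    intro i h1 h2 j h3 h4
    have h := hLlb i (Finset.mem_Icc.2 ⟨h1, h2⟩) j (Finset.mem_Icc.2 ⟨h3, h4⟩)
    rw [hM] at h
    have h' : (M : ℚ) ≤ |(l i : ℚ) - l' j| := by linarith
    exact_mod_cast h'
  have hb : |t - κ| < L + 1 / 2 ↔ (-M < S ∧ S < M + 2) := by
    have e : t - κ = (S : ℚ) / 2 - 1 / 2 := by rw [hκ, ← hS]; ring
    rw [e, hM, abs_lt]
    constructor
    · rintro ⟨h1, h2⟩
      have h3 : (-M : ℚ) < S := by linarith
      have h4 : (S : ℚ) < M + 2 := by linarith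
      exact ⟨by exact_mod_cast h3, by exact_mod_cast h4⟩
    · rintro ⟨h1, h2⟩
      have h3 : (-M : ℚ) < S := by exact_mod_cast h1
      have h4 : (S : ℚ) < M + 2 := by exact_mod_cast h2
      constructor <;> linarith
  have key : ∀ i ∈ Finset.Icc 1 (n / 2), ∀ j ∈ Finset.Icc 1 (m / 2),
      (((¬ InZle0 (t - κ' + ((l i : ℚ) + l' j) / 2) ∧
        ¬ InZle0 (1 - t + κ' + ((l i : ℚ) + l' j) / 2)) ∧
      (l i ≠ l' j →
        ¬ InZle0 (t - κ' + (|l i - l' j| : ℚ) / 2) ∧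
        ¬ InZle0 (1 - t + κ' + (|l i - l' j| : ℚ) / 2)) ∧
      (l i = l' j →
        ¬ In2Zle0 (t - κ') ∧ ¬ In2Zle0 (t - κ' + 1) ∧
        ¬ In2Zle0 (1 - t + κ') ∧ ¬ In2Zle0 (2 - t + κ'))) ↔
      (-|l i - l' j| < S ∧ S < |l i - l' j| + 2)) := by
    intro i hi j hj
    rw [Finset.mem_Icc] at hi hj
    have pi := pos_aux n w l hl hne i hi.1 hi.2
    have pj := pos_aux m w' l' hl' hme j hj.1 hj.2
    have ci := hl.2.2 i hi.1 (by omega)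
    have cj := hl'.2.2 j hj.1 (by omega)
    obtain ⟨A, hA⟩ : ∃ A : ℤ, A = |l i - l' j| := ⟨_, rfl⟩
    have hA' : |(l i : ℚ) - l' j| = (A : ℚ) := by rw [hA]; push_cast; rfl
    have hAc : (A = l i - l' j ∨ A = l' j - l i) ∧ 0 ≤ A := by
      rcases abs_cases (l i - l' j) with h | h <;> omega
    have hS' : 1 - t + κ' = ((2 - S : ℤ) : ℚ) / 2 := by push_cast; linarith
    have hS2 : 2 - t + κ' = ((4 - S : ℤ) : ℚ) / 2 := by push_cast; linarith
    rw [hA', ← hA, hS', hS, hS2,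
      zle0_iff _ (S + (l i + l' j)) (by push_cast; ring) (by omega),
      zle0_iff _ (2 - S + (l i + l' j)) (by push_cast; ring) (by omega),
      zle0_iff _ (S + A) (by push_cast; ring) (by omega),
      zle0_iff _ (2 - S + A) (by push_cast; ring) (by omega)]
    by_cases hij : l i = l' j
    · rw [two_zle0_iff _ S rfl (by omega),
        two_zle0_iff _ (S + 2) (by push_cast; ring) (by omega),
        two_zle0_iff _ (2 - S) (by push_cast; ring) (by omega),
        two_zle0_iff _ (4 - S) (by push_cast; ring) (by omega)]
      simp only [hij, ne_eq, not_true_eq_false, false_imp_iff, true_imp_iff, true_and]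
      omega
    · simp only [hij, ne_eq, not_false_eq_true, false_imp_iff, true_imp_iff, and_true]
      omega
  rw [hb]
  constructor
  · intro h
    obtain ⟨i₀, a1, a2, a3, a4⟩ := half_aux n w l hl hne i₁ hi₁.1 hi₁.2
    obtain ⟨j₀, b1, b2, b3, b4⟩ := half_aux m w' l' hl' hme j₁ hj₁.1 hj₁.2
    have hi := Finset.mem_Icc.2 ⟨a1, a2⟩
    have hj := Finset.mem_Icc.2 ⟨b1, b2⟩
    have h' := (key i₀ hi j₀ hj).1 (h i₀ hi j₀ hj)
    have : |l i₀ - l' j₀| ≤ M := by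
      rw [hMd]
      rcases abs_cases (l i₀ - l' j₀) with h | h <;>
      rcases abs_cases (l i₁ - l' j₁) with h' | h' <;> omega
    omega
  · intro h i hi j hj
    refine (key i hi j hj).2 ?_
    rw [Finset.mem_Icc] at hi hj
    have := hlb i hi.1 (by omega) j hj.1 (by omega)
    omega
end

section
/- Let n ≥ 2 be even, m ≥ 1 odd, (w,l) ∈ L⁺₀(n), (w',l') ∈ L⁺₀(m), and set κ' := (w+w')/2, κ := κ' + 1/2 and L := (1/2)·min{|l_i − l'_j| : 1 ≤ i ≤ n, 1 ≤ j ≤ m}. Then for every t ∈ (n+m)/2 + ℤ the following are equivalent: (a) for all 1 ≤ i ≤ n/2 and 1 ≤ j ≤ (m−1)/2 one has t − κ' + (l_i + l'_j)/2 ∉ ℤ≤0 and 1 − t + κ' + (l_i + l'_j)/2 ∉ ℤ≤0; if l_i ≠ l'_j, also t − κ' + |l_i − l'_j|/2 ∉ ℤ≤0 and 1 − t + κ' + |l_i − l'_j|/2 ∉ ℤ≤0; if l_i = l'_j, none of t − κ', t − κ' + 1, 1 − t + κ', 2 − t + κ' lies in 2ℤ≤0; and moreover for every 1 ≤ i ≤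 n/2 one has t − κ' + l_i/2 ∉ ℤ≤0 and 1 − t + κ' + l_i/2 ∉ ℤ≤0; (b) |t − κ| < L + 1/2. -/
theorem crit_aux (X d : ℤ) (hp : (X + d) % 2 = 0) (x c : ℚ) (hx : x = X / 2) (hc : c = d / 2) :
    (¬ InZle0 (x + c) ∧ ¬ InZle0 (1 - x + c)) ↔ |x - 1 / 2| < c + 1 / 2 := by
  obtain ⟨k, hk⟩ : ∃ k : ℤ, X = 2 * k - d := ⟨(X + d) / 2, by omega⟩
  have h1 : x + c = (k : ℚ) := by rw [hx, hc, hk]; push_cast; ring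
  have h2 : 1 - x + c = ((1 + d - k : ℤ) : ℚ) := by rw [hx, hc, hk]; push_cast; ring
  have e : ∀ a : ℤ, InZle0 (a : ℚ) ↔ a ≤ 0 := by
    intro a
    constructor
    · rintro ⟨z, hz, h⟩
      have : a = z := by exact_mod_cast h
      omega
    · intro h
      exact ⟨a, h, rfl⟩
  rw [h2, h1, e, e, abs_lt]
  constructor
  · rintro ⟨h3, h4⟩
    have h5 : (1 : ℚ) ≤ k := by exact_mod_cast (by omega : (1 : ℤ) ≤ k)
    have h6 : (1 : ℚ) ≤ ((1 + d - k : ℤ) : ℚ) := by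
      exact_mod_cast (by omega : (1 : ℤ) ≤ 1 + d - k)
    rw [← h1] at h5
    rw [← h2] at h6
    constructor <;> linarith
  · rintro ⟨h3, h4⟩
    have h5 : (0 : ℚ) < k := by rw [← h1]; linarith
    have h6 : (0 : ℚ) < ((1 + d - k : ℤ) : ℚ) := by rw [← h2]; linarith
    have h5' : 0 < k := by exact_mod_cast h5
    have h6' : 0 < 1 + d - k := by exact_mod_cast h6
    omega

theorem crit_aux2 (X : ℤ) (hp : X % 2 = 0) (x : ℚ) (hx : x = X / 2) :
    ¬ (¬ In2Zle0 x ∧ ¬ In2Zle0 (x + 1) ∧ ¬ In2Zle0 (1 - x) ∧ ¬ In2Zle0 (2 - x)) := by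
  rintro ⟨h1, h2, h3, h4⟩
  obtain ⟨k, hk⟩ : ∃ k : ℤ, X = 2 * k := ⟨X / 2, by omega⟩
  have hxk : x = k := by rw [hx, hk]; push_cast; ring
  rcases Int.even_or_odd' k with ⟨a, ha | ha⟩
  · by_cases h : a ≤ 0
    · exact h1 ⟨a, h, by rw [hxk, ha]; push_cast; ring⟩
    · exact h4 ⟨1 - a, by omega, by rw [hxk, ha]; push_cast; ring⟩
  · by_cases h : a + 1 ≤ 0
    · exact h2 ⟨a + 1, h, by rw [hxk, ha]; push_cast; ring⟩
    · exact h3 ⟨- a, by omega, by rw [hxk, ha]; push_cast; ring⟩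

theorem param_anti {n : ℕ} {w : ℤ} {l : ℕ → ℤ} (h : IsLanglandsParam n w l)
    (i k : ℕ) (hi : 1 ≤ i) (hk : i + (k + 1) ≤ n) : l (i + (k + 1)) < l i := by
  induction k with
  | zero => exact h.1 i hi (by omega)
  | succ k ih =>
    have := ih (by omega)
    have h2 := h.1 (i + (k + 1)) (by omega) (by omega)
    exact lt_trans h2 this

theorem param_pos {n : ℕ} {w : ℤ} {l : ℕ → ℤ} (h : IsLanglandsParam n w l)
    (i : ℕ) (hi : 1 ≤ i) (hk : 2 * i ≤ n) : 0 < l i := by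
  have h1 := param_anti h i (n - 2 * i) hi (by omega)
  have h2 := h.2.1 i hi (by omega)
  rw [show i + (n - 2 * i + 1) = n + 1 - i by omega] at h1
  omega

theorem param_cases {n : ℕ} {w : ℤ} {l : ℕ → ℤ} (h : IsLanglandsParam n w l)
    (i : ℕ) (hi : 1 ≤ i) (hk : i ≤ n) :
    l i = 0 ∧ 2 * i = n + 1 ∨ ∃ j, 1 ≤ j ∧ 2 * j ≤ n ∧ (l i = l j ∨ l i = - l j) := by
  have h2 := h.2.1 i hi hk
  rcases lt_trichotomy (2 * i) (n + 1) with h3 | h3 | h3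
  · exact Or.inr ⟨i, hi, by omega, Or.inl rfl⟩
  · rw [show n + 1 - i = i by omega] at h2
    exact Or.inl ⟨by omega, h3⟩
  · exact Or.inr ⟨n + 1 - i, by omega, by omega, Or.inr (by omega)⟩

theorem criticality_criterion_even_odd
    (n m : ℕ) (hn : 2 ≤ n) (hm : 1 ≤ m) (hne : Even n) (hmo : Odd m)
    (w w' : ℤ) (l l' : ℕ → ℤ)
    (hl : IsLanglandsParam n w l) (hl' : IsLanglandsParam m w' l')
    (κ' κ L : ℚ) (hκ' : κ' = ((w : ℚ) + w') / 2) (hκ : κ = κ' + 1 / 2)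
    -- `L` is half the minimum of `|l_i - l'_j|` over all `1 ≤ i ≤ n`, `1 ≤ j ≤ m`:
    (hLlb : ∀ i ∈ Finset.Icc 1 n, ∀ j ∈ Finset.Icc 1 m, L ≤ (|l i - l' j| : ℚ) / 2)
    (hLmem : ∃ i ∈ Finset.Icc 1 n, ∃ j ∈ Finset.Icc 1 m, L = (|l i - l' j| : ℚ) / 2)
    (t : ℚ) (ht : ∃ z : ℤ, t = ((n : ℚ) + m) / 2 + z) :
    ((∀ i ∈ Finset.Icc 1 (n / 2), ∀ j ∈ Finset.Icc 1 ((m - 1) / 2),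
      (¬ InZle0 (t - κ' + ((l i : ℚ) + l' j) / 2) ∧
        ¬ InZle0 (1 - t + κ' + ((l i : ℚ) + l' j) / 2)) ∧
      (l i ≠ l' j →
        ¬ InZle0 (t - κ' + (|l i - l' j| : ℚ) / 2) ∧
        ¬ InZle0 (1 - t + κ' + (|l i - l' j| : ℚ) / 2)) ∧
      (l i = l' j →
        ¬ In2Zle0 (t - κ') ∧ ¬ In2Zle0 (t - κ' + 1) ∧
        ¬ In2Zle0 (1 - t + κ') ∧ ¬ In2Zle0 (2 - t + κ'))) ∧
     (∀ i ∈ Finset.Icc 1 (n / 2),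
        ¬ InZle0 (t - κ' + (l i : ℚ) / 2) ∧
        ¬ InZle0 (1 - t + κ' + (l i : ℚ) / 2))) ↔
    |t - κ| < L + 1 / 2 := by
  obtain ⟨z, hz⟩ := ht
  obtain ⟨X, hX⟩ : ∃ X : ℤ, X = n + m + 2 * z - w - w' := ⟨_, rfl⟩
  have hx : t - κ' = (X : ℚ) / 2 := by rw [hz, hκ', hX]; push_cast; ring
  have hn2 : n % 2 = 0 := Nat.even_iff.mp hne
  have hm2 : m % 2 = 1 := Nat.odd_iff.mp hmo
  obtain ⟨x, hxd⟩ : ∃ x, x = t - κ' := ⟨_, rfl⟩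
  have r1 : ∀ c, 1 - t + κ' + c = 1 - x + c := by intro c; rw [hxd]; ring
  have r2 : 1 - t + κ' = 1 - x := by rw [hxd]; ring
  have r3 : 2 - t + κ' = 2 - x := by rw [hxd]; ring
  have r4 : t - κ = x - 1 / 2 := by rw [hxd, hκ]; ring
  simp only [r1, r2, r3, r4, ← hxd]
  rw [← hxd] at hx
  have pl : ∀ i, 1 ≤ i → i ≤ n → (X + l i) % 2 = 0 := by
    intro i h1 h2
    have a := hl.2.2 i h1 h2
    have b := hl'.2.2 ((m + 1) / 2) (by omega) (by omega)
    have c := hl'.2.1 ((m + 1) / 2) (by omega) (by omega)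
    rw [show m + 1 - (m + 1) / 2 = (m + 1) / 2 by omega] at c
    omega
  have pl' : ∀ j, 1 ≤ j → j ≤ m → l' j % 2 = 0 := by
    intro j h1 h2
    have a := hl'.2.2 j h1 h2
    have b := hl'.2.2 ((m + 1) / 2) (by omega) (by omega)
    have c := hl'.2.1 ((m + 1) / 2) (by omega) (by omega)
    rw [show m + 1 - (m + 1) / 2 = (m + 1) / 2 by omega] at c
    omega
  have pabs : ∀ i j, 1 ≤ i → i ≤ n → 1 ≤ j → j ≤ m → (X + |l i - l' j|) % 2 = 0 := by
    intro i j h1 h2 h3 h4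
    have a := pl i h1 h2
    have b := pl' j h3 h4
    rcases abs_choice (l i - l' j) with h | h <;> rw [h] <;> omega
  have A1 : ∀ i j, 1 ≤ i → i ≤ n → 1 ≤ j → j ≤ m →
      ((¬ InZle0 (x + ((l i : ℚ) + l' j) / 2) ∧ ¬ InZle0 (1 - x + ((l i : ℚ) + l' j) / 2)) ↔
        |x - 1 / 2| < ((l i : ℚ) + l' j) / 2 + 1 / 2) := by
    intro i j h1 h2 h3 h4
    refine crit_aux X (l i + l' j) ?_ x _ hx (by push_cast; ring)
    have a := pl i h1 h2
    have b := pl' j h3 h4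
    omega
  have A2 : ∀ i j, 1 ≤ i → i ≤ n → 1 ≤ j → j ≤ m →
      ((¬ InZle0 (x + (|l i - l' j| : ℚ) / 2) ∧ ¬ InZle0 (1 - x + (|l i - l' j| : ℚ) / 2)) ↔
        |x - 1 / 2| < (|l i - l' j| : ℚ) / 2 + 1 / 2) := by
    intro i j h1 h2 h3 h4
    exact crit_aux X |l i - l' j| (pabs i j h1 h2 h3 h4) x _ hx (by push_cast; ring)
  have A3 : ∀ i, 1 ≤ i → i ≤ n →
      ((¬ InZle0 (x + (l i : ℚ) / 2) ∧ ¬ InZle0 (1 - x + (l i : ℚ) / 2)) ↔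
        |x - 1 / 2| < (l i : ℚ) / 2 + 1 / 2) := by
    intro i h1 h2
    exact crit_aux X (l i) (pl i h1 h2) x _ hx rfl
  have A4 : ∀ i j, 1 ≤ i → i ≤ n → 1 ≤ j → j ≤ m → l i = l' j → X % 2 = 0 := by
    intro i j h1 h2 h3 h4 h
    have a := pl i h1 h2
    have b := pl' j h3 h4
    omega
  simp only [Finset.mem_Icc] at *
  constructor
  · rintro ⟨H, H0⟩
    obtain ⟨i, ⟨hi1, hi2⟩, j, ⟨hj1, hj2⟩, hL⟩ := hLmem
    rw [hL]
    rcases param_cases hl i hi1 hi2 with ⟨-, h⟩ | ⟨i₀, a1, a2, hi⟩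
    · omega
    rcases param_cases hl' j hj1 hj2 with ⟨h0, -⟩ | ⟨j₀, b1, b2, hj⟩
    · have h := (A3 i₀ a1 (by omega)).1 (H0 i₀ ⟨a1, by omega⟩)
      rw [h0, Int.cast_zero, sub_zero]
      have : (l i₀ : ℚ) ≤ |(l i : ℚ)| := by
        rcases hi with e | e <;> rw [e]
        · simpa using le_abs_self _
        · simpa using le_abs_self _
      linarith
    · obtain ⟨B1, B2, B3⟩ := H i₀ ⟨a1, by omega⟩ j₀ ⟨b1, by omega⟩
      have C1 := (A1 i₀ j₀ a1 (by omega) b1 (by omega)).1 B1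
      have hne' : l i₀ ≠ l' j₀ := fun e =>
        crit_aux2 X (A4 i₀ j₀ a1 (by omega) b1 (by omega) e) x hx (B3 e)
      have C2 := (A2 i₀ j₀ a1 (by omega) b1 (by omega)).1 (B2 hne')
      have D1 := le_abs_self ((l i₀ : ℚ) + l' j₀)
      have D2 := abs_neg ((l i₀ : ℚ) + l' j₀)
      have D3 := abs_neg ((l i₀ : ℚ) - l' j₀)
      rcases hi with e | e <;> rcases hj with f | f <;> rw [e, f] <;> push_cast
      · exact C2
      · rw [show (l i₀ : ℚ) - -(l' j₀ : ℚ) = l i₀ + l' j₀ by ring]; linarith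
      · rw [show -(l i₀ : ℚ) - (l' j₀ : ℚ) = -(l i₀ + l' j₀) by ring]; linarith
      · rw [show -(l i₀ : ℚ) - -(l' j₀ : ℚ) = -(l i₀ - l' j₀) by ring]; linarith
  · intro hb
    refine ⟨?_, ?_⟩
    · rintro i ⟨hi1, hi2⟩ j ⟨hj1, hj2⟩
      have hi3 : i ≤ n := by omega
      have hj3 : j ≤ m := by omega
      have E := hLlb i ⟨hi1, hi3⟩ j ⟨hj1, hj3⟩
      have C2 := (A2 i j hi1 hi3 hj1 hj3).2 (by linarith)
      refine ⟨(A1 i j hi1 hi3 hj1 hj3).2 ?_, fun _ => C2, fun e => ?_⟩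
      · have F := hLlb i ⟨hi1, hi3⟩ (m + 1 - j) ⟨by omega, by omega⟩
        have s := hl'.2.1 j hj1 hj3
        have s' : l' (m + 1 - j) = - l' j := by omega
        have p1 : (0 : ℚ) < l i := by exact_mod_cast param_pos hl i hi1 (by omega)
        have p2 : (0 : ℚ) < l' j := by exact_mod_cast param_pos hl' j hj1 (by omega)
        rw [s'] at F
        push_cast at F
        rw [sub_neg_eq_add, abs_of_pos (by linarith)] at F
        linarith
      · exfalso
        have hXe := A4 i j hi1 hi3 hj1 hj3 e
        have := (crit_aux X 0 (by omega) x 0 hx (by simp)).2 (by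
          rw [e, sub_self, abs_zero] at E
          linarith)
        obtain ⟨k, hk⟩ : ∃ k : ℤ, X = 2 * k := ⟨X / 2, by omega⟩
        have hxk : x = k := by rw [hx, hk]; push_cast; ring
        by_cases h : k ≤ 0
        · exact this.1 ⟨k, h, by rw [hxk]; ring⟩
        · exact this.2 ⟨1 - k, by omega, by rw [hxk]; push_cast; ring⟩
    · rintro i ⟨hi1, hi2⟩
      have hi3 : i ≤ n := by omega
      refine (A3 i hi1 hi3).2 ?_
      have F := hLlb i ⟨hi1, hi3⟩ ((m + 1) / 2) ⟨by omega, by omega⟩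
      have c := hl'.2.1 ((m + 1) / 2) (by omega) (by omega)
      rw [show m + 1 - (m + 1) / 2 = (m + 1) / 2 by omega] at c
      have c' : l' ((m + 1) / 2) = 0 := by omega
      have p1 : (0 : ℚ) < l i := by exact_mod_cast param_pos hl i hi1 (by omega)
      rw [c', Int.cast_zero, sub_zero, abs_of_pos p1] at F
      linarith
end

section
/- Let n, m ≥ 1 be odd with (n,m) ≠ (1,1), let (w,l) ∈ L⁺₀(n), (w',l') ∈ L⁺₀(m), fix ε ∈ {0,1}, and set κ' := (w+w')/2, κ := κ' + 1/2 and L := (1/2)·min{|l_i − l'_j| : 1 ≤ i ≤ n, 1 ≤ j ≤ m, (i,j) ≠ ((n+1)/2,(m+1)/2)}. Then for every t ∈ (n+m)/2 + ℤ the following are equivalent: (a) for all 1 ≤ i ≤ (n−1)/2 and 1 ≤ j ≤ (m−1)/2 one has t − κ' + (l_i + l'_j)/2 ∉ ℤ≤0 and 1 − t + κ' + (l_i + l'_j)/2 ∉ ℤ≤0; if l_i ≠ l'_j also t − κ' + |l_i − l'_j|/2 ∉ ℤ≤0 and 1 − t + κ' + |l_i − l'_j|/2 ∉ ℤ≤0;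 if l_i = l'_j none of t − κ', t − κ' + 1, 1 − t + κ', 2 − t + κ' lies in 2ℤ≤0; for every 1 ≤ i ≤ (n−1)/2: t − κ' + l_i/2 ∉ ℤ≤0 and 1 − t + κ' + l_i/2 ∉ ℤ≤0; for every 1 ≤ j ≤ (m−1)/2: t − κ' + l'_j/2 ∉ ℤ≤0 and 1 − t + κ' + l'_j/2 ∉ ℤ≤0; and t − κ' + ε ∉ 2ℤ≤0 and 1 − t + κ' + ε ∉ 2ℤ≤0; (b) |t − κ| < L + 1/2 and t − κ' ∈ Z_ε, where Z_ε := {2a − ε : a ∈ ℤ, a ≥ 1} ∪ {−(2a − 1 − ε) : a ∈ ℤ, a ≥ 1}. -/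
/-- `x ∈ Z_ε = (2ℕ - ε) ∪ -(2ℕ - 1 - ε)` where `ℕ = {1, 2, 3, …}`. -/
def ZEps (ε : ℤ) (x : ℤ) : Prop :=
  (∃ a : ℤ, 1 ≤ a ∧ x = 2 * a - ε) ∨ (∃ a : ℤ, 1 ≤ a ∧ x = -(2 * a - 1 - ε))


theorem aux_prop {A B C A' B' C' D : Prop} (h1 : A ↔ A') (h2 : B ↔ B') (h3 : C ↔ C') :
    (A ∧ B ∧ C ∧ D) ↔ ((A' ∧ B' ∧ C') ∧ D) := by
  rw [h1, h2, h3, and_assoc, and_assoc]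

theorem aux_inZ (q : ℚ) (z : ℤ) (h : q = z) : InZle0 q ↔ z ≤ 0 := by
  subst h
  constructor
  · rintro ⟨y, hy, e⟩
    have : z = y := by exact_mod_cast e
    omega
  · intro hz
    exact ⟨z, hz, rfl⟩

theorem aux_in2Z (q : ℚ) (z : ℤ) (h : q = z) : In2Zle0 q ↔ (z ≤ 0 ∧ z % 2 = 0) := by
  subst h
  constructor
  · rintro ⟨y, hy, e⟩
    have : z = 2 * y := by exact_mod_cast e
    omega
  · rintro ⟨hz, h2⟩
    refine ⟨z / 2, by omega, ?_⟩
    have : z = 2 * (z / 2) := by omega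
    exact_mod_cast this

theorem aux_param (p : ℕ) (w : ℤ) (l : ℕ → ℤ) (h : IsLanglandsParam (2 * p + 1) w l) :
    ∃ (W : ℤ) (a : ℕ → ℤ), w = 2 * W ∧ (∀ i, 1 ≤ i → i ≤ 2 * p + 1 → l i = 2 * a i) ∧
      a (p + 1) = 0 ∧ (∀ i, 1 ≤ i → i ≤ p → 0 < a i) ∧
      (∀ i, 1 ≤ i → i ≤ 2 * p + 1 → a i = - a (2 * p + 2 - i)) := by
  obtain ⟨h1, h2, h3⟩ := h
  have h0 : l (p + 1) = 0 := by
    have := h2 (p + 1) (by omega) (by omega)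
    rw [show 2 * p + 1 + 1 - (p + 1) = p + 1 by omega] at this
    omega
  have hw : w % 2 = 0 := by
    have := h3 (p + 1) (by omega) (by omega)
    push_cast at this
    omega
  have he : ∀ i, 1 ≤ i → i ≤ 2 * p + 1 → l i = 2 * (l i / 2) := by
    intro i hi hi'
    have := h3 i hi hi'
    push_cast at this
    omega
  have hpos : ∀ k, k + 1 ≤ p → 0 < l (p - k) := by
    intro k
    induction k with
    | zero =>
      intro hk
      have := h1 p (by omega) (by omega)
      simp only [Nat.sub_zero]
      omega
    | succ k ih =>
      intro hk
      have := ih (by omega)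
      have h := h1 (p - (k + 1)) (by omega) (by omega)
      rw [show p - (k + 1) + 1 = p - k by omega] at h
      omega
  refine ⟨w / 2, fun i => l i / 2, by omega, he, by simp [h0], ?_, ?_⟩
  · intro i hi hi'
    have h := hpos (p - i) (by omega)
    rw [show p - (p - i) = i by omega] at h
    have := he i hi (by omega)
    show 0 < l i / 2
    omega
  · intro i hi hi'
    have h := h2 i hi hi'
    rw [show 2 * p + 1 + 1 - i = 2 * p + 2 - i by omega] at h
    have e1 := he i hi hi'
    have e2 := he (2 * p + 2 - i) (by omega) (by omega)
    show l i / 2 = - (l (2 * p + 2 - i) / 2)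
    omega

theorem aux_core (p q : ℕ) (a b : ℕ → ℤ) (x M : ℤ)
    (a0 : a (p + 1) = 0) (apos : ∀ i, 1 ≤ i → i ≤ p → 0 < a i)
    (asym : ∀ i, 1 ≤ i → i ≤ 2 * p + 1 → a i = - a (2 * p + 2 - i))
    (b0 : b (q + 1) = 0) (bpos : ∀ i, 1 ≤ i → i ≤ q → 0 < b i)
    (bsym : ∀ i, 1 ≤ i → i ≤ 2 * q + 1 → b i = - b (2 * q + 2 - i))
    (hlb : ∀ i, 1 ≤ i → i ≤ 2 * p + 1 → ∀ j, 1 ≤ j → j ≤ 2 * q + 1 →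
      ¬ (i = p + 1 ∧ j = q + 1) → M ≤ |a i - b j|)
    (hmem : ∃ i, 1 ≤ i ∧ i ≤ 2 * p + 1 ∧ ∃ j, 1 ≤ j ∧ j ≤ 2 * q + 1 ∧
      ¬ (i = p + 1 ∧ j = q + 1) ∧ M = |a i - b j|) :
    ((∀ i, 1 ≤ i → i ≤ p → ∀ j, 1 ≤ j → j ≤ q →
      (0 < x + (a i + b j) ∧ 0 < 1 - x + (a i + b j)) ∧
      (0 < x + |a i - b j| ∧ 0 < 1 - x + |a i - b j|)) ∧
     (∀ i, 1 ≤ i → i ≤ p → 0 < x + a i ∧ 0 < 1 - x + a i) ∧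
     (∀ j, 1 ≤ j → j ≤ q → 0 < x + b j ∧ 0 < 1 - x + b j)) ↔
    (-M < x ∧ x < 1 + M) := by
  constructor
  · rintro ⟨h1, h2, h3⟩
    obtain ⟨i, hi, hi', j, hj, hj', hne, rfl⟩ := hmem
    have A := asym i hi hi'
    have B := bsym j hj hj'
    have PA : i ≤ p ∨ i = p + 1 ∨ (1 ≤ 2 * p + 2 - i ∧ 2 * p + 2 - i ≤ p) := by omega
    have PB : j ≤ q ∨ j = q + 1 ∨ (1 ≤ 2 * q + 2 - j ∧ 2 * q + 2 - j ≤ q) := by omega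
    rcases PA with PA | PA | ⟨PA, PA'⟩ <;> rcases PB with PB | PB | ⟨PB, PB'⟩
    · have := h1 i hi PA j hj PB
      omega
    · subst PB
      have := h2 i hi PA
      have := apos i hi PA
      rw [b0, sub_zero, abs_of_pos this]
      omega
    · have := h1 i hi PA _ PB PB'
      have := apos i hi PA
      have := bpos _ PB PB'
      rw [B, abs_of_pos (by omega)]
      omega
    · subst PA
      have := h3 j hj PB
      have := bpos j hj PB
      rw [a0, abs_of_neg (by omega)]
      omega
    · exact absurd ⟨PA, PB⟩ hne
    · subst PA
      have := h3 _ PB PB'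
      have := bpos _ PB PB'
      rw [a0, B, abs_of_pos (by omega)]
      omega
    · have := h1 _ PA PA' j hj PB
      have := apos _ PA PA'
      have := bpos j hj PB
      rw [A, abs_of_neg (by omega)]
      omega
    · subst PB
      have := h2 _ PA PA'
      have := apos _ PA PA'
      rw [b0, A, abs_of_neg (by omega)]
      omega
    · have := h1 _ PA PA' _ PB PB'
      rw [A, B, show ∀ u v : ℤ, -u - -v = -(u - v) by intros; ring, abs_neg]
      omega
  · rintro ⟨h1, h2⟩
    refine ⟨?_, ?_, ?_⟩
    · intro i hi hi' j hj hj'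
      have e1 := hlb i hi (by omega) j hj (by omega) (by omega)
      have e2 := hlb i hi (by omega) (2 * q + 2 - j) (by omega) (by omega) (by omega)
      have B := bsym j hj (by omega)
      have := apos i hi hi'
      have := bpos j hj hj'
      rw [show a i - b (2 * q + 2 - j) = a i + b j by omega, abs_of_pos (by omega)] at e2
      omega
    · intro i hi hi'
      have e1 := hlb i hi (by omega) (q + 1) (by omega) (by omega) (by omega)
      have := apos i hi hi'
      rw [b0, sub_zero, abs_of_pos this] at e1
      omega
    · intro j hj hj'
      have e1 := hlb (p + 1) (by omega) (by omega) j (by omega) (by omega) (by omega)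
      have := bpos j hj hj'
      rw [a0, abs_of_neg (by omega)] at e1
      omega

theorem criticality_criterion_odd_odd
    (n m : ℕ) (hn : 1 ≤ n) (hm : 1 ≤ m) (hno : Odd n) (hmo : Odd m)
    (hnm : ¬(n = 1 ∧ m = 1))
    (w w' : ℤ) (l l' : ℕ → ℤ)
    (hl : IsLanglandsParam n w l) (hl' : IsLanglandsParam m w' l')
    (ε : ℤ) (hε : ε = 0 ∨ ε = 1)
    (κ' κ L : ℚ) (hκ' : κ' = ((w : ℚ) + w') / 2) (hκ : κ = κ' + 1 / 2)
    -- `L` is half the minimum of `|l_i - l'_j|` over all `1 ≤ i ≤ n`, `1 ≤ j ≤ m`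
    -- with `(i,j) ≠ ((n+1)/2, (m+1)/2)`:
    (hLlb : ∀ i ∈ Finset.Icc 1 n, ∀ j ∈ Finset.Icc 1 m,
      (i, j) ≠ ((n + 1) / 2, (m + 1) / 2) → L ≤ (|l i - l' j| : ℚ) / 2)
    (hLmem : ∃ i ∈ Finset.Icc 1 n, ∃ j ∈ Finset.Icc 1 m,
      (i, j) ≠ ((n + 1) / 2, (m + 1) / 2) ∧ L = (|l i - l' j| : ℚ) / 2)
    (t : ℚ) (ht : ∃ z : ℤ, t = ((n : ℚ) + m) / 2 + z) :
    ((∀ i ∈ Finset.Icc 1 ((n - 1) / 2), ∀ j ∈ Finset.Icc 1 ((m - 1) / 2),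
      (¬ InZle0 (t - κ' + ((l i : ℚ) + l' j) / 2) ∧
        ¬ InZle0 (1 - t + κ' + ((l i : ℚ) + l' j) / 2)) ∧
      (l i ≠ l' j →
        ¬ InZle0 (t - κ' + (|l i - l' j| : ℚ) / 2) ∧
        ¬ InZle0 (1 - t + κ' + (|l i - l' j| : ℚ) / 2)) ∧
      (l i = l' j →
        ¬ In2Zle0 (t - κ') ∧ ¬ In2Zle0 (t - κ' + 1) ∧
        ¬ In2Zle0 (1 - t + κ') ∧ ¬ In2Zle0 (2 - t + κ'))) ∧
     (∀ i ∈ Finset.Icc 1 ((n - 1) / 2),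
        ¬ InZle0 (t - κ' + (l i : ℚ) / 2) ∧
        ¬ InZle0 (1 - t + κ' + (l i : ℚ) / 2)) ∧
     (∀ j ∈ Finset.Icc 1 ((m - 1) / 2),
        ¬ InZle0 (t - κ' + (l' j : ℚ) / 2) ∧
        ¬ InZle0 (1 - t + κ' + (l' j : ℚ) / 2)) ∧
     (¬ In2Zle0 (t - κ' + ε) ∧ ¬ In2Zle0 (1 - t + κ' + ε))) ↔
    (|t - κ| < L + 1 / 2 ∧ ∃ x : ℤ, ZEps ε x ∧ t - κ' = x) := by
  obtain ⟨p, rfl⟩ := hno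
  obtain ⟨q, rfl⟩ := hmo
  obtain ⟨W, a, rfl, ha, a0, apos, asym⟩ := aux_param p w l hl
  obtain ⟨W', b, rfl, hb, b0, bpos, bsym⟩ := aux_param q w' l' hl'
  obtain ⟨z, hz⟩ := ht
  obtain ⟨x, hx⟩ : ∃ x : ℤ, t - κ' = x := by
    refine ⟨p + q + 1 + z - W - W', ?_⟩
    rw [hz, hκ']; push_cast; ring
  have habs : ∀ i, 1 ≤ i → i ≤ 2 * p + 1 → ∀ j, 1 ≤ j → j ≤ 2 * q + 1 →
      (|(l i : ℚ) - l' j| : ℚ) / 2 = ((|a i - b j| : ℤ) : ℚ) := by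
    intro i hi hi' j hj hj'
    rw [ha i hi hi', hb j hj hj']
    push_cast
    rw [show (2 * (a i : ℚ) - 2 * b j) = 2 * (a i - b j) by ring, abs_mul, abs_two]
    ring
  obtain ⟨i₀, hi₀, j₀, hj₀, hne₀, hL⟩ := hLmem
  rw [Finset.mem_Icc] at hi₀ hj₀
  rw [habs i₀ hi₀.1 hi₀.2 j₀ hj₀.1 hj₀.2] at hL
  have hp1 : (2 * p + 1 + 1) / 2 = p + 1 := by omega
  have hq1 : (2 * q + 1 + 1) / 2 = q + 1 := by omega
  have hp2 : (2 * p + 1 - 1) / 2 = p := by omega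
  have hq2 : (2 * q + 1 - 1) / 2 = q := by omega
  rw [hp1, hq1] at hne₀ hLlb
  rw [hp2, hq2]
  have core := aux_core p q a b x |a i₀ - b j₀| a0 apos asym b0 bpos bsym
    (by
      intro i hi hi' j hj hj' hne
      have := hLlb i (Finset.mem_Icc.2 ⟨hi, hi'⟩) j (Finset.mem_Icc.2 ⟨hj, hj'⟩)
        (by rwa [Ne, Prod.mk.injEq])
      rw [habs i hi hi' j hj hj', hL] at this
      exact_mod_cast this)
    ⟨i₀, hi₀.1, hi₀.2, j₀, hj₀.1, hj₀.2, by rwa [Ne, Prod.mk.injEq] at hne₀, rfl⟩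
  have hb1 : |t - κ| < L + 1 / 2 ↔ (-|a i₀ - b j₀| < x ∧ x < 1 + |a i₀ - b j₀|) := by
    rw [show t - κ = (x : ℚ) - 1 / 2 by rw [hκ, ← hx]; ring, hL, abs_lt]
    constructor
    · rintro ⟨u, v⟩
      constructor
      · have : (((-|a i₀ - b j₀| : ℤ)) : ℚ) < x := by
          rw [Int.cast_neg]; linarith
        exact_mod_cast this
      · have : (x : ℚ) < ((1 + |a i₀ - b j₀| : ℤ) : ℚ) := by
          rw [Int.cast_add, Int.cast_one]; linarith
        exact_mod_cast this
    · rintro ⟨u, v⟩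
      have u' : (((-|a i₀ - b j₀| : ℤ)) : ℚ) < x := by exact_mod_cast u
      have v' : (x : ℚ) < ((1 + |a i₀ - b j₀| : ℤ) : ℚ) := by exact_mod_cast v
      rw [Int.cast_neg] at u'
      rw [Int.cast_add, Int.cast_one] at v'
      constructor <;> linarith
  have hb2 : (∃ y : ℤ, ZEps ε y ∧ t - κ' = y) ↔
      (¬ In2Zle0 (t - κ' + ε) ∧ ¬ In2Zle0 (1 - t + κ' + ε)) := by
    rw [aux_in2Z _ (x + ε) (by rw [hx]; push_cast; ring),
      aux_in2Z _ (1 - x + ε) (by push_cast; rw [← hx]; ring)]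
    constructor
    · rintro ⟨y, hy, e⟩
      have : x = y := by rw [hx] at e; exact_mod_cast e
      subst this
      rcases hy with ⟨c, hc, e⟩ | ⟨c, hc, e⟩ <;> rcases hε with rfl | rfl <;> omega
    · intro h
      refine ⟨x, ?_, hx⟩
      by_cases hpos : (x + ε) % 2 = 0
      · exact Or.inl ⟨(x + ε) / 2, by omega, by omega⟩
      · exact Or.inr ⟨(1 + ε - x) / 2, by omega, by omega⟩
  rw [hb1, ← core, hb2]
  refine aux_prop ?_ ?_ ?_
  · refine forall_congr' fun i => ?_
    rw [Finset.mem_Icc, and_imp]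
    refine forall_congr' fun hi => forall_congr' fun hi' => forall_congr' fun j => ?_
    rw [Finset.mem_Icc, and_imp]
    refine forall_congr' fun hj => forall_congr' fun hj' => ?_
    have hA := ha i hi (by omega)
    have hB := hb j hj (by omega)
    rw [habs i hi (by omega) j hj (by omega),
      aux_inZ _ (x + (a i + b j)) (by rw [hx, hA, hB]; push_cast; ring),
      aux_inZ _ (1 - x + (a i + b j)) (by rw [hA, hB]; push_cast; rw [← hx]; ring),
      aux_inZ _ (x + |a i - b j|) (by rw [hx]; push_cast; ring),
      aux_inZ _ (1 - x + |a i - b j|) (by push_cast; rw [← hx]; ring),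
      aux_in2Z _ x hx, aux_in2Z _ (x + 1) (by rw [hx]; push_cast; ring),
      aux_in2Z _ (1 - x) (by push_cast; rw [← hx]; ring),
      aux_in2Z _ (2 - x) (by push_cast; rw [← hx]; ring)]
    by_cases hab : l i = l' j
    · have : a i = b j := by omega
      simp only [ne_eq, hab, this, sub_self, abs_zero, not_true_eq_false, false_imp_iff, true_imp_iff,
        true_and]
      omega
    · simp only [ne_eq, hab, not_false_eq_true, false_imp_iff, true_imp_iff, and_true, not_le]
  · refine forall_congr' fun i => ?_
    rw [Finset.mem_Icc, and_imp]
    refine forall_congr' fun hi => forall_congr' fun hi' => ?_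
    have hA := ha i hi (by omega)
    rw [aux_inZ _ (x + a i) (by rw [hx, hA]; push_cast; ring),
      aux_inZ _ (1 - x + a i) (by rw [hA]; push_cast; rw [← hx]; ring)]
    omega
  · refine forall_congr' fun i => ?_
    rw [Finset.mem_Icc, and_imp]
    refine forall_congr' fun hi => forall_congr' fun hi' => ?_
    have hA := hb i hi (by omega)
    rw [aux_inZ _ (x + b i) (by rw [hx, hA]; push_cast; ring),
      aux_inZ _ (1 - x + b i) (by rw [hA]; push_cast; rw [← hx]; ring)]
    omega
end

section
/- Let (w,l) ∈ L⁺₀(n) and (w',l') ∈ L⁺₀(m), set κ := (w+w'+1)/2 and L := (1/2)·min |l_i − l'_j|, the minimum over all pairs (i,j) with 1 ≤ i ≤ n, 1 ≤ j ≤ m except that when n and m are both odd the pair (i,j) = ((n+1)/2,(m+1)/2) is excluded. If there exists t ∈ (m+n)/2 + ℤ with |t − κ| < L + 1/2, then for every pair (i,j) with 1 ≤ i ≤ n and 1 ≤ j ≤ m one has the alternative: l_i ≠ l'_j, or l_i = l'_j = 0; and the second case occurs only when n ≡ m ≡ 1 (mod 2) and i = (n+1)/2, j = (m+1)/2. -/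
theorem parameter_alternative_of_critical
    (n m : ℕ) (hn : 1 ≤ n) (hm : 1 ≤ m)
    (w w' : ℤ) (l l' : ℕ → ℤ)
    (hl : IsLanglandsParam n w l) (hl' : IsLanglandsParam m w' l')
    (κ L : ℚ) (hκ : κ = ((w : ℚ) + w' + 1) / 2)
    -- `L` is half the minimum of `|l_i - l'_j|` over all `1 ≤ i ≤ n`, `1 ≤ j ≤ m`,
    -- the pair `(i,j) = ((n+1)/2, (m+1)/2)` being excluded when `n` and `m` are both odd:
    (hLlb : ∀ i ∈ Finset.Icc 1 n, ∀ j ∈ Finset.Icc 1 m,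
      ¬(Odd n ∧ Odd m ∧ i = (n + 1) / 2 ∧ j = (m + 1) / 2) → L ≤ (|l i - l' j| : ℚ) / 2)
    (hLmem : ∃ i ∈ Finset.Icc 1 n, ∃ j ∈ Finset.Icc 1 m,
      ¬(Odd n ∧ Odd m ∧ i = (n + 1) / 2 ∧ j = (m + 1) / 2) ∧ L = (|l i - l' j| : ℚ) / 2)
    (hcrit : ∃ t : ℚ, (∃ z : ℤ, t = ((m : ℚ) + n) / 2 + z) ∧ |t - κ| < L + 1 / 2) :
    ∀ i ∈ Finset.Icc 1 n, ∀ j ∈ Finset.Icc 1 m,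
      l i ≠ l' j ∨
      (l i = 0 ∧ l' j = 0 ∧ Odd n ∧ Odd m ∧ i = (n + 1) / 2 ∧ j = (m + 1) / 2) := by
  intro i hi j hj
  by_cases heq : l i = l' j
  swap
  · exact Or.inl heq
  right
  obtain ⟨-, hs, hp⟩ := hl
  obtain ⟨-, hs2, hp2⟩ := hl'
  have hLij := hLlb i hi j hj
  rw [Finset.mem_Icc] at hi hj
  by_cases hex : Odd n ∧ Odd m ∧ i = (n + 1) / 2 ∧ j = (m + 1) / 2
  · obtain ⟨h1, h2, h3, h4⟩ := hex
    have a := hs i hi.1 hi.2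
    have e : n + 1 - i = i := by
      obtain ⟨k, hk⟩ := h1
      omega
    rw [e] at a
    exact ⟨by omega, by omega, h1, h2, h3, h4⟩
  · exfalso
    have hL := hLij hex
    rw [heq] at hL
    simp only [sub_self, abs_zero, zero_div] at hL
    obtain ⟨t, ⟨z, hz⟩, ht⟩ := hcrit
    have a := hp i hi.1 hi.2
    have b := hp2 j hj.1 hj.2
    rw [abs_lt] at ht
    obtain ⟨t1, t2⟩ := ht
    have u1 : (-1 : ℚ) < ((m + n + 2 * z - w - w' - 1 : ℤ) : ℚ) := by
      push_cast
      linarith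
    have u2 : ((m + n + 2 * z - w - w' - 1 : ℤ) : ℚ) < 1 := by
      push_cast
      linarith
    have v1 : (-1 : ℤ) < m + n + 2 * z - w - w' - 1 := by exact_mod_cast u1
    have v2 : (m + n + 2 * z - w - w' - 1 : ℤ) < 1 := by exact_mod_cast u2
    omega
end

section
/- Let (w,l) ∈ L⁺₀(n) and (w',l') ∈ L⁺₀(m) with n and m not both odd, set κ := (w+w'+1)/2 and L := (1/2)·min{|l_i − l'_j| : 1 ≤ i ≤ n, 1 ≤ j ≤ m}. Then there exists t ∈ (m+n)/2 + ℤ with |t − κ| < L + 1/2 if and only if l_i ≠ l'_j for all pairs (i,j). Moreover, if l_i ≠ l'_j for all (i,j) and the number t₀ := L − 1 + (w+w'+1)/2 belongs to (m+n)/2 + ℤ, then both t₀ and w + w' + 1 − t₀ satisfy |t − κ| < L + 1/2 (i.e. are critical). -/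
theorem critical_number_exists_iff_nonexceptional
    (n m : ℕ) (hn : 1 ≤ n) (hm : 1 ≤ m) (hnm : ¬(Odd n ∧ Odd m))
    (w w' : ℤ) (l l' : ℕ → ℤ)
    (hl : IsLanglandsParam n w l) (hl' : IsLanglandsParam m w' l')
    (κ L : ℚ) (hκ : κ = ((w : ℚ) + w' + 1) / 2)
    -- `L` is half the minimum of `|l_i - l'_j|` over all `1 ≤ i ≤ n`, `1 ≤ j ≤ m`:
    (hLlb : ∀ i ∈ Finset.Icc 1 n, ∀ j ∈ Finset.Icc 1 m, L ≤ (|l i - l' j| : ℚ) / 2)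
    (hLmem : ∃ i ∈ Finset.Icc 1 n, ∃ j ∈ Finset.Icc 1 m, L = (|l i - l' j| : ℚ) / 2)
    (t₀ : ℚ) (ht₀ : t₀ = L - 1 + ((w : ℚ) + w' + 1) / 2) :
    ((∃ t : ℚ, (∃ z : ℤ, t = ((m : ℚ) + n) / 2 + z) ∧ |t - κ| < L + 1 / 2) ↔
      (∀ i ∈ Finset.Icc 1 n, ∀ j ∈ Finset.Icc 1 m, l i ≠ l' j)) ∧
    ((∀ i ∈ Finset.Icc 1 n, ∀ j ∈ Finset.Icc 1 m, l i ≠ l' j) →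
      (∃ z : ℤ, t₀ = ((m : ℚ) + n) / 2 + z) →
      |t₀ - κ| < L + 1 / 2 ∧ |((w : ℚ) + w' + 1 - t₀) - κ| < L + 1 / 2) := by
  obtain ⟨-, -, hp⟩ := hl
  obtain ⟨-, -, hp'⟩ := hl'
  have half : (∀ i ∈ Finset.Icc 1 n, ∀ j ∈ Finset.Icc 1 m, l i ≠ l' j) → 1 / 2 ≤ L := by
    intro h
    obtain ⟨i, hi, j, hj, e⟩ := hLmem
    have h1 : (1 : ℤ) ≤ |l i - l' j| := Int.one_le_abs (sub_ne_zero.mpr (h i hi j hj))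
    have h2 : (1 : ℚ) ≤ |(l i : ℚ) - l' j| := by exact_mod_cast h1
    rw [e]
    linarith
  refine ⟨⟨?_, ?_⟩, ?_⟩
  · rintro ⟨t, ⟨z, rfl⟩, ht⟩ i hi j hj e
    have hL := hLlb i hi j hj
    rw [e, sub_self, abs_zero] at hL
    rw [Finset.mem_Icc] at hi hj
    have a := hp i hi.1 hi.2
    have b := hp' j hj.1 hj.2
    rw [e] at a
    rw [hκ, abs_lt] at ht
    obtain ⟨h1, h2⟩ := ht
    have h3 : (-1 : ℚ) < m + n + 2 * z - (w + w' + 1) := by linarith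
    have h4 : (m + n + 2 * z - (w + w' + 1) : ℚ) < 1 := by linarith
    have h5 : (-1 : ℤ) < m + n + 2 * z - (w + w' + 1) := by exact_mod_cast h3
    have h6 : (m + n + 2 * z - (w + w' + 1) : ℤ) < 1 := by exact_mod_cast h4
    omega
  · intro h
    have hL := half h
    obtain ⟨z, h1, h2⟩ : ∃ z : ℤ, (-1 : ℤ) ≤ m + n + 2 * z - (w + w' + 1) ∧
        (m + n + 2 * z - (w + w' + 1) : ℤ) ≤ 1 :=
      ⟨(w + w' + 1 - m - n) / 2, by omega, by omega⟩
    have h3 : (-1 : ℚ) ≤ m + n + 2 * z - (w + w' + 1) := by exact_mod_cast h1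
    have h4 : (m + n + 2 * z - (w + w' + 1) : ℚ) ≤ 1 := by exact_mod_cast h2
    refine ⟨_, ⟨z, rfl⟩, ?_⟩
    rw [hκ, abs_lt]
    constructor <;> linarith
  · intro h _
    have hL := half h
    rw [hκ, ht₀, abs_lt, abs_lt]
    refine ⟨⟨?_, ?_⟩, ?_, ?_⟩ <;> linarith
end

section
/- Let (w,l) ∈ L⁺₀(n) and (w',l') ∈ L⁺₀(m) satisfy l₁ > l'₁ and the condition that for every pair (i,j) either l_i ≠ l'_j or l_i = l'_j = 0 (the latter only possible when n and m are both odd and i = (n+1)/2, j = (m+1)/2), and let a be the position tuple. Then a_j + a_{m+1−j} = n for all j ∈ {1,…,m}, except that in the exceptional case n ≡ m ≡ 1 (mod 2) the index j = (m+1)/2 instead satisfies a_{(m+1)/2} = (n−1)/2. -/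
/-- `a` is the position tuple: `1 ≤ a_j ≤ n - 1` and `l_{a_j} > l'_j ≥ l_{1+a_j}`
for `j = 1, …, m`. -/
def IsPositionTuple (n m : ℕ) (l l' : ℕ → ℤ) (a : ℕ → ℕ) : Prop :=
  ∀ j, 1 ≤ j → j ≤ m →
    1 ≤ a j ∧ a j ≤ n - 1 ∧ l' j < l (a j) ∧ l (1 + a j) ≤ l' j

theorem lp_anti {n : ℕ} {w : ℤ} {l : ℕ → ℤ} (hl : IsLanglandsParam n w l) (i : ℕ) (hi : 1 ≤ i)
    (k : ℕ) (hik : i < k) (hk : k ≤ n) : l k < l i := by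
  induction k, hik using Nat.le_induction with
  | base => exact hl.1 i hi (by omega)
  | succ k hk' ih =>
    have h1 := ih (by omega)
    have h2 := hl.1 k (by omega) (by omega)
    omega

theorem lp_unique {n : ℕ} {w : ℤ} {l : ℕ → ℤ} (hl : IsLanglandsParam n w l) (x : ℤ) (p q : ℕ)
    (hp : 1 ≤ p) (hpn : p ≤ n - 1) (hq : 1 ≤ q) (hqn : q ≤ n - 1)
    (h1 : x < l p) (h2 : l (1 + p) ≤ x) (h3 : x < l q) (h4 : l (1 + q) ≤ x) : p = q := by
  rcases lt_trichotomy p q with h | h | h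
  · rcases Nat.eq_or_lt_of_le (show 1 + p ≤ q by omega) with e | e
    · rw [e] at h2; omega
    · have := lp_anti hl (1 + p) (by omega) q e (by omega)
      omega
  · exact h
  · rcases Nat.eq_or_lt_of_le (show 1 + q ≤ p by omega) with e | e
    · rw [e] at h4; omega
    · have := lp_anti hl (1 + q) (by omega) p e (by omega)
      omega

theorem lp_zero {n : ℕ} {w : ℤ} {l : ℕ → ℤ} (hl : IsLanglandsParam n w l) (i : ℕ) (hi : 1 ≤ i)
    (hin : i ≤ n) : l i = 0 ↔ i = n + 1 - i := by
  have h := hl.2.1 i hi hin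
  constructor
  · intro h0
    rcases lt_trichotomy i (n + 1 - i) with e | e | e
    · have := lp_anti hl i hi _ e (by omega)
      omega
    · exact e
    · have := lp_anti hl (n + 1 - i) (by omega) _ e (by omega)
      omega
  · intro e
    rw [← e] at h
    omega

theorem position_tuple_symmetry
    (n m : ℕ) (hn : 1 ≤ n) (hm : 1 ≤ m)
    (w w' : ℤ) (l l' : ℕ → ℤ)
    (hl : IsLanglandsParam n w l) (hl' : IsLanglandsParam m w' l')
    (hfirst : l' 1 < l 1)
    (halt : ∀ i ∈ Finset.Icc 1 n, ∀ j ∈ Finset.Icc 1 m,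
      l i ≠ l' j ∨ (l i = 0 ∧ l' j = 0))
    (a : ℕ → ℕ) (ha : IsPositionTuple n m l l' a) :
    ∀ j ∈ Finset.Icc 1 m,
      (¬(Odd n ∧ Odd m ∧ j = (m + 1) / 2) → a j + a (m + 1 - j) = n) ∧
      (Odd n → Odd m → j = (m + 1) / 2 → a j = (n - 1) / 2) := by
  intro j hj
  obtain ⟨hj1, hjm⟩ := Finset.mem_Icc.mp hj
  obtain ⟨p1, p2, p3, p4⟩ := ha j hj1 hjm
  obtain ⟨q1, q2, q3, q4⟩ := ha (m + 1 - j) (by omega) (by omega)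
  have hs := hl'.2.1 j hj1 hjm
  have hz := lp_zero hl' j hj1 hjm
  refine ⟨fun hne => ?_, fun on om hje => ?_⟩
  · have hstrict : l (1 + a j) ≠ l' j := by
      rcases halt (1 + a j) (Finset.mem_Icc.mpr ⟨by omega, by omega⟩) j hj with h | ⟨h, h'⟩
      · exact h
      · exfalso
        have e1 := (lp_zero hl (1 + a j) (by omega) (by omega)).mp h
        have e2 := hz.mp h'
        refine hne ⟨⟨a j, by omega⟩, ⟨j - 1, by omega⟩, by omega⟩
    have r1 := hl.2.1 (a j) p1 (by omega)
    have r2 := hl.2.1 (1 + a j) (by omega) (by omega)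
    rw [show n + 1 - a j = 1 + (n - a j) by omega] at r1
    rw [show n + 1 - (1 + a j) = n - a j by omega] at r2
    have := lp_unique hl (l' (m + 1 - j)) (a (m + 1 - j)) (n - a j) q1 q2 (by omega) (by omega)
      q3 q4 (by omega) (by omega)
    omega
  · obtain ⟨c, hc⟩ := on
    obtain ⟨d, hd⟩ := om
    have h0 : l' j = 0 := hz.mpr (by omega)
    have hc0 : l (1 + c) = 0 := (lp_zero hl (1 + c) (by omega) (by omega)).mpr (by omega)
    have hc1 := lp_anti hl c (by omega) (1 + c) (by omega) (by omega)
    have := lp_unique hl (l' j) (a j) c p1 p2 (by omega) (by omega) p3 p4 (by omega) (by omega)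
    omega
end

section
/- Let m > 1, let (w,l) ∈ L⁺₀(n) and (w',l') ∈ L⁺₀(m) satisfy l₁ > l'₁ and the condition that for every pair (i,j) either l_i ≠ l'_j or l_i = l'_j = 0, let a be the position tuple, and let j₁ < … < j_k be its jump indices. Then: (i) if n and m are not both odd, j is a jump index if and only if m − j is a jump index; (ii) if n ≡ m ≡ 1 (mod 2), then for j ∉ {(m−1)/2, (m+1)/2} the index j is a jump index if and only if m − j is, the index (m+1)/2 is always a jump index, and (m−1)/2 is a jump index if and only if l_{(n−1)/2} < l'_{(m−1)/2}, which in turn is equivalent to k being even; (iii) except in the exceptional case with k odd, j_κ + j_{k+1−κ} = m for κ = 1,…,k; in the exceptional case with k odd this symmetry holds for all κ ≠ (k+1)/2, and j_{(k+1)/2} = (m+1)/2. -/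
/-- `j ∈ {1, …, m-1}` is a jump index of `a` when `a_j < a_{j+1}`. -/
def IsJumpIdx (m : ℕ) (a : ℕ → ℕ) (j : ℕ) : Prop :=
  1 ≤ j ∧ j ≤ m - 1 ∧ a j < a (j + 1)

/-- `J 1 < J 2 < … < J k` enumerates the jump indices of `a`. -/
def JumpEnum (m : ℕ) (a : ℕ → ℕ) (k : ℕ) (J : ℕ → ℕ) : Prop :=
  (∀ c₁ c₂, 1 ≤ c₁ → c₁ < c₂ → c₂ ≤ k → J c₁ < J c₂) ∧
  (∀ c, 1 ≤ c → c ≤ k → IsJumpIdx m a (J c)) ∧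
  (∀ j, IsJumpIdx m a j → ∃ c, 1 ≤ c ∧ c ≤ k ∧ J c = j)

theorem enum_unique (P : ℕ → Prop) (k : ℕ) (A B : ℕ → ℕ)
    (hA : ∀ c₁ c₂, 1 ≤ c₁ → c₁ < c₂ → c₂ ≤ k → A c₁ < A c₂)
    (hB : ∀ c₁ c₂, 1 ≤ c₁ → c₁ < c₂ → c₂ ≤ k → B c₁ < B c₂)
    (hAP : ∀ c, 1 ≤ c → c ≤ k → P (A c)) (hBP : ∀ c, 1 ≤ c → c ≤ k → P (B c))
    (hAs : ∀ j, P j → ∃ c, 1 ≤ c ∧ c ≤ k ∧ A c = j)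
    (hBs : ∀ j, P j → ∃ c, 1 ≤ c ∧ c ≤ k ∧ B c = j) :
    ∀ c, 1 ≤ c → c ≤ k → A c = B c := by
  intro c
  induction c using Nat.strong_induction_on with
  | _ c ih =>
    intro h1 h2
    obtain ⟨d, d1, d2, d3⟩ := hBs _ (hAP c h1 h2)
    obtain ⟨e, e1, e2, e3⟩ := hAs _ (hBP c h1 h2)
    rcases lt_trichotomy d c with h | h | h
    · have := ih d h d1 d2
      have := hA d c d1 h h2
      omega
    · subst h; exact d3.symm
    · have x1 := hB c d h1 h d2
      rcases lt_trichotomy e c with g | g | g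
      · have := ih e g e1 e2
        have := hB e c e1 g h2
        omega
      · subst g; exact e3
      · have := hA c e h1 g e2
        omega

theorem enum_rev (P : ℕ → Prop) (k : ℕ) (A f : ℕ → ℕ)
    (hA : ∀ c₁ c₂, 1 ≤ c₁ → c₁ < c₂ → c₂ ≤ k → A c₁ < A c₂)
    (hAP : ∀ c, 1 ≤ c → c ≤ k → P (A c))
    (hAs : ∀ j, P j → ∃ c, 1 ≤ c ∧ c ≤ k ∧ A c = j)
    (hf : ∀ x, P x → P (f x)) (hanti : ∀ x y, P x → P y → x < y → f y < f x)
    (hinv : ∀ x, P x → f (f x) = x) :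
    ∀ c, 1 ≤ c → c ≤ k → A c = f (A (k + 1 - c)) := by
  refine enum_unique P k A (fun c => f (A (k + 1 - c))) hA ?_ hAP ?_ hAs ?_
  · intro c₁ c₂ h1 h h2
    exact hanti _ _ (hAP _ (by omega) (by omega)) (hAP _ (by omega) (by omega))
      (hA _ _ (by omega) (by omega) (by omega))
  · intro c h1 h2
    exact hf _ (hAP _ (by omega) (by omega))
  · intro j hj
    obtain ⟨c, c1, c2, c3⟩ := hAs _ (hf j hj)
    refine ⟨k + 1 - c, by omega, by omega, ?_⟩
    have : k + 1 - (k + 1 - c) = c := by omega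
    simp only [this, c3]
    exact hinv j hj

theorem strict_anti_on (n : ℕ) (l : ℕ → ℤ) (h : ∀ i, 1 ≤ i → i < n → l (i + 1) < l i) :
    ∀ i j, 1 ≤ i → i < j → j ≤ n → l j < l i := by
  intro i j h1 hij
  induction j, hij using Nat.le_induction with
  | base => intro h2; exact h i h1 (by omega)
  | succ j hj ih =>
    intro h2
    have := ih (by omega)
    have := h j (by omega) (by omega)
    omega

theorem jump_index_symmetry
    (n m : ℕ) (hn : 1 ≤ n) (hm : 1 < m)
    (w w' : ℤ) (l l' : ℕ → ℤ)
    (hl : IsLanglandsParam n w l) (hl' : IsLanglandsParam m w' l')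
    (hfirst : l' 1 < l 1)
    (halt : ∀ i ∈ Finset.Icc 1 n, ∀ j ∈ Finset.Icc 1 m,
      l i ≠ l' j ∨ (l i = 0 ∧ l' j = 0))
    (a : ℕ → ℕ) (ha : IsPositionTuple n m l l' a)
    (k : ℕ) (J : ℕ → ℕ) (hJ : JumpEnum m a k J) :
    -- (i) non-exceptional case
    (¬(Odd n ∧ Odd m) → ∀ j, 1 ≤ j → j ≤ m - 1 →
      (IsJumpIdx m a j ↔ IsJumpIdx m a (m - j))) ∧
    -- (ii) exceptional case
    (Odd n → Odd m →
      (∀ j, 1 ≤ j → j ≤ m - 1 → j ≠ (m - 1) / 2 → j ≠ (m + 1) / 2 →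
        (IsJumpIdx m a j ↔ IsJumpIdx m a (m - j))) ∧
      IsJumpIdx m a ((m + 1) / 2) ∧
      (IsJumpIdx m a ((m - 1) / 2) ↔ l ((n - 1) / 2) < l' ((m - 1) / 2)) ∧
      (l ((n - 1) / 2) < l' ((m - 1) / 2) ↔ Even k)) ∧
    -- (iii) symmetry of the jump indices
    (¬(Odd n ∧ Odd m ∧ Odd k) → ∀ c, 1 ≤ c → c ≤ k → J c + J (k + 1 - c) = m) ∧
    (Odd n → Odd m → Odd k →
      (∀ c, 1 ≤ c → c ≤ k → c ≠ (k + 1) / 2 → J c + J (k + 1 - c) = m) ∧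
      J ((k + 1) / 2) = (m + 1) / 2) := by
  obtain ⟨hs, hsym, -⟩ := hl
  obtain ⟨hs', hsym', -⟩ := hl'
  have L := strict_anti_on n l hs
  have L' := strict_anti_on m l' hs'
  -- position characterisation
  have uniq : ∀ j b, 1 ≤ j → j ≤ m → 1 ≤ b → b + 1 ≤ n → l' j < l b → l (1 + b) ≤ l' j →
      a j = b := by
    intro j b h1 h2 b1 b2 b3 b4
    obtain ⟨p1, p2, p3, p4⟩ := ha j h1 h2
    rcases lt_trichotomy (a j) b with h | h | h
    · rcases Nat.lt_or_ge (1 + a j) b with g | g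
      · have := L _ _ (by omega) g (by omega); omega
      · have : 1 + a j = b := by omega
        rw [this] at p4; omega
    · exact h
    · rcases Nat.lt_or_ge (1 + b) (a j) with g | g
      · have := L _ _ (by omega) g (by omega); omega
      · have : 1 + b = a j := by omega
        rw [this] at b4; omega
  have mono : ∀ j, 1 ≤ j → j + 1 ≤ m → a j ≤ a (j + 1) := by
    intro j h1 h2
    obtain ⟨p1, p2, p3, p4⟩ := ha j h1 (by omega)
    obtain ⟨q1, q2, q3, q4⟩ := ha (j + 1) (by omega) h2
    have := hs' j h1 (by omega)
    by_contra hc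
    rcases Nat.lt_or_ge (1 + a (j + 1)) (a j) with g | g
    · have := L _ _ (by omega) g (by omega); omega
    · have e : 1 + a (j + 1) = a j := by omega
      rw [e] at q4; omega
  have zero' : ∀ j, 1 ≤ j → j ≤ m → l' j = 0 → j + j = m + 1 := by
    intro j h1 h2 h0
    have := hsym' j h1 h2
    rcases lt_trichotomy j (m + 1 - j) with h | h | h
    · have := L' _ _ h1 h (by omega); omega
    · omega
    · have := L' _ _ (by omega) h (by omega); omega
  have zero : ∀ j, 1 ≤ j → j ≤ n → l j = 0 → j + j = n + 1 := by
    intro j h1 h2 h0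
    have := hsym j h1 h2
    rcases lt_trichotomy j (n + 1 - j) with h | h | h
    · have := L _ _ h1 h (by omega); omega
    · omega
    · have := L _ _ (by omega) h (by omega); omega
  have ne : ∀ i j, 1 ≤ i → i ≤ n → 1 ≤ j → j ≤ m → ¬ (i + i = n + 1 ∧ j + j = m + 1) →
      l i ≠ l' j := by
    intro i j i1 i2 j1 j2 h
    rcases halt i (Finset.mem_Icc.2 ⟨i1, i2⟩) j (Finset.mem_Icc.2 ⟨j1, j2⟩) with g | ⟨g1, g2⟩
    · exact g
    · exact absurd ⟨zero i i1 i2 g1, zero' j j1 j2 g2⟩ h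
  have refl : ∀ j, 1 ≤ j → j ≤ m → ¬ (Odd n ∧ Odd m ∧ j + j = m + 1) →
      a (m + 1 - j) = n - a j := by
    intro j h1 h2 h
    obtain ⟨p1, p2, p3, p4⟩ := ha j h1 h2
    have hne : l (1 + a j) ≠ l' j := by
      apply ne _ _ (by omega) (by omega) h1 h2
      rintro ⟨g1, g2⟩
      apply h
      refine ⟨⟨a j, by omega⟩, ⟨j - 1, by omega⟩, g2⟩
    have s1 := hsym' j h1 h2
    have s2 := hsym (a j) p1 (by omega)
    have s3 := hsym (1 + a j) (by omega) (by omega)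
    have e2 : n + 1 - a j = 1 + (n - a j) := by omega
    have e3 : n + 1 - (1 + a j) = n - a j := by omega
    rw [e2] at s2
    rw [e3] at s3
    apply uniq _ _ (by omega) (by omega) (by omega) (by omega) <;> omega
  have key : ∀ j, 1 ≤ j → j ≤ m - 1 → (¬ (Odd n ∧ Odd m) ∨ (j ≠ (m - 1) / 2 ∧ j ≠ (m + 1) / 2)) →
      (IsJumpIdx m a j ↔ IsJumpIdx m a (m - j)) := by
    intro j h1 h2 h
    have r1 := refl j h1 (by omega) (by
      rintro ⟨g1, g2, g3⟩
      rcases h with h | h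
      · exact h ⟨g1, g2⟩
      · omega)
    have r2 := refl (j + 1) (by omega) (by omega) (by
      rintro ⟨g1, g2, g3⟩
      rcases h with h | h
      · exact h ⟨g1, g2⟩
      · omega)
    have e1 : m + 1 - j = m - j + 1 := by omega
    have e2 : m + 1 - (j + 1) = m - j := by omega
    rw [e1] at r1
    rw [e2] at r2
    have := ha j h1 (by omega)
    have := ha (j + 1) (by omega) (by omega)
    unfold IsJumpIdx
    omega
  obtain ⟨J1, J2, J3⟩ := hJ
  -- symmetric enumeration
  have symJ : (∀ j, 1 ≤ j → j ≤ m - 1 → (IsJumpIdx m a j ↔ IsJumpIdx m a (m - j))) →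
      ∀ c, 1 ≤ c → c ≤ k → J c + J (k + 1 - c) = m := by
    intro h c c1 c2
    have := enum_rev (IsJumpIdx m a) k J (fun x => m - x) J1 J2 J3
      (fun x hx => (h x hx.1 hx.2.1).1 hx)
      (fun x y hx hy hxy => by have := hx.2.1; have := hy.2.1; show m - y < m - x; omega)
      (fun x hx => by have := hx.2.1; show m - (m - x) = x; omega) c c1 c2
    have h3 := (J2 (k + 1 - c) (by omega) (by omega)).2.1
    omega
  -- exceptional data
  have exc : Odd n → Odd m → IsJumpIdx m a ((m + 1) / 2) ∧
      (IsJumpIdx m a ((m - 1) / 2) ↔ l ((n - 1) / 2) < l' ((m - 1) / 2)) := by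
    rintro ⟨p, hp⟩ ⟨q, hq⟩
    have e1 : (m + 1) / 2 = q + 1 := by omega
    have e2 : (m - 1) / 2 = q := by omega
    have e3 : (n - 1) / 2 = p := by omega
    rw [e1, e2, e3]
    have n2 := ha 1 le_rfl (by omega)
    have z' := hsym' (q + 1) (by omega) (by omega)
    have f1 : m + 1 - (q + 1) = q + 1 := by omega
    rw [f1] at z'
    have z := hsym (p + 1) (by omega) (by omega)
    have f2 : n + 1 - (p + 1) = p + 1 := by omega
    rw [f2] at z
    have hp1 := L p (p + 1) (by omega) (by omega) (by omega)
    have aq : a (q + 1) = p := by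
      apply uniq _ _ (by omega) (by omega) (by omega) (by omega)
      · omega
      · rw [Nat.add_comm 1 p]; omega
    have mq := mono q (by omega) (by omega)
    have r := refl q (by omega) (by omega) (by rintro ⟨-, -, g⟩; omega)
    have f3 : m + 1 - q = q + 1 + 1 := by omega
    rw [f3] at r
    obtain ⟨p1, p2, p3, p4⟩ := ha q (by omega) (by omega)
    refine ⟨⟨by omega, by omega, by omega⟩, ?_⟩
    constructor
    · rintro ⟨-, -, h⟩
      have hne := ne p q (by omega) (by omega) (by omega) (by omega) (by omega)
      rcases Nat.lt_or_ge (1 + a q) p with g | g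
      · have := L _ _ (by omega) g (by omega); omega
      · have e : 1 + a q = p := by omega
        rw [e] at p4; omega
    · intro h
      refine ⟨by omega, by omega, ?_⟩
      rcases Nat.lt_or_ge (a q) p with g | g
      · omega
      · have e : a q = p := by omega
        rw [e] at p3; omega
  have excSym : Odd n → Odd m → IsJumpIdx m a ((m - 1) / 2) →
      ∀ j, 1 ≤ j → j ≤ m - 1 → (IsJumpIdx m a j ↔ IsJumpIdx m a (m - j)) := by
    intro on om h j j1 j2
    obtain ⟨x1, -⟩ := exc on om
    by_cases g1 : j = (m - 1) / 2
    · have e : m - j = (m + 1) / 2 := by obtain ⟨q, hq⟩ := om; omega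
      rw [e, g1]; exact iff_of_true h x1
    · by_cases g2 : j = (m + 1) / 2
      · have e : m - j = (m - 1) / 2 := by obtain ⟨q, hq⟩ := om; omega
        rw [e, g2]; exact iff_of_true x1 h
      · exact key j j1 j2 (Or.inr ⟨g1, g2⟩)
  have evenK : Odd n → Odd m → IsJumpIdx m a ((m - 1) / 2) → Even k := by
    intro on om h
    by_contra hk
    rw [Nat.not_even_iff_odd] at hk
    obtain ⟨r, hr⟩ := hk
    have := symJ (excSym on om h) (r + 1) (by omega) (by omega)
    have e : k + 1 - (r + 1) = r + 1 := by omega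
    rw [e] at this
    obtain ⟨q, hq⟩ := om
    omega
  have oddK : Odd n → Odd m → ¬ IsJumpIdx m a ((m - 1) / 2) → Odd k ∧
      (∀ c, 1 ≤ c → c ≤ k → c ≠ (k + 1) / 2 → J c + J (k + 1 - c) = m) ∧
      J ((k + 1) / 2) = (m + 1) / 2 := by
    intro on om h
    obtain ⟨x1, -⟩ := exc on om
    have om' := om
    obtain ⟨q, hq⟩ := om'
    have e1 : (m + 1) / 2 = q + 1 := by omega
    have e2 : (m - 1) / 2 = q := by omega
    rw [e2] at h
    rw [e1] at x1 ⊢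
    have nq : ∀ x, IsJumpIdx m a x → x ≠ q := by
      rintro x hx rfl; exact h hx
    have R := enum_rev (IsJumpIdx m a) k J (fun x => if x = q + 1 then q + 1 else m - x) J1 J2 J3
      (fun x hx => by
        show IsJumpIdx m a (if x = q + 1 then q + 1 else m - x)
        split_ifs with g
        · exact x1
        · exact (key x hx.1 hx.2.1 (Or.inr ⟨by rw [e2]; exact nq x hx, by omega⟩)).1 hx)
      (fun x y hx hy hxy => by
        have := hx.2.1; have := hy.2.1; have := nq x hx; have := nq y hy
        show (if y = q + 1 then q + 1 else m - y) < (if x = q + 1 then q + 1 else m - x)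
        split_ifs <;> omega)
      (fun x hx => by
        have := hx.2.1; have := nq x hx
        split_ifs <;> omega)
    obtain ⟨d, d1, d2, d3⟩ := J3 _ x1
    have hd : k + 1 - d = d := by
      have h1 := R d d1 d2
      have h2 := nq _ (J2 (k + 1 - d) (by omega) (by omega))
      have h5 : J (k + 1 - d) = J d := by
        split_ifs at h1 <;> omega
      rcases lt_trichotomy (k + 1 - d) d with g | g | g
      · have := J1 _ _ (by omega) g (by omega); omega
      · exact g
      · have := J1 _ _ (by omega) g (by omega); omega
    have hd2 : (k + 1) / 2 = d := by omega
    refine ⟨⟨d - 1, by omega⟩, ?_, by rw [hd2]; exact d3⟩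
    intro c c1 c2 hc
    have h1 := R c c1 c2
    have h2 := (J2 (k + 1 - c) (by omega) (by omega)).2.1
    have h3 : J (k + 1 - c) ≠ q + 1 := by
      rw [← d3]
      rcases lt_trichotomy (k + 1 - c) d with g | g | g
      · have := J1 _ _ (by omega) g (by omega); omega
      · omega
      · have := J1 _ _ (by omega) g (by omega); omega
    rw [if_neg h3] at h1
    omega
  refine ⟨fun h j j1 j2 => key j j1 j2 (Or.inl h), ?_, ?_, ?_⟩
  · intro on om
    obtain ⟨x1, x2⟩ := exc on om
    refine ⟨fun j j1 j2 h1 h2 => key j j1 j2 (Or.inr ⟨h1, h2⟩), x1, x2, ?_⟩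
    rw [← x2]
    refine ⟨evenK on om, fun hk => ?_⟩
    by_contra hc
    exact Nat.not_even_iff_odd.2 (oddK on om hc).1 hk
  · intro h
    by_cases g : Odd n ∧ Odd m
    · apply symJ
      apply excSym g.1 g.2
      by_contra hc
      exact h ⟨g.1, g.2, (oddK g.1 g.2 hc).1⟩
    · exact symJ (fun j j1 j2 => key j j1 j2 (Or.inl g))
  · intro on om ok
    refine (oddK on om ?_).2
    intro hc
    exact Nat.not_even_iff_odd.2 ok (evenK on om hc)
end

section
/- Let μ ∈ X⁺₀(n) and ν ∈ X⁺₀(m) correspond to Langlands parameters (w,l) ∈ L⁺₀(n) and (w',l') ∈ L⁺₀(m), assume l₁ > l'₁ and that for every pair (i,j) either l_i ≠ l'_j or l_i = l'_j = 0, let a be the position tuple and define λ ∈ ℤ^m by λ_j := ν_j + a_j − j. Then λ is dominant (λ₁ ≥ λ₂ ≥ … ≥ λ_m), and λ_j + λ_{m+1−j} = w' + n − m − 1 for all j ≠ (m+1)/2; in the non-exceptional case (n, m not both odd) this purity identity holds for all j, while in the exceptional case n ≡ m ≡ 1 (mod 2) one additionally has 2·λ_{(m+1)/2} = w' + n − m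 − 2. -/
/-- `μ` is dominant with purity weight `W`: `μ₁ ≥ … ≥ μ_n` and `μ_i + μ_{n+1-i} = W`. -/
def IsDominantPure (n : ℕ) (μ : ℕ → ℤ) (W : ℤ) : Prop :=
  (∀ i, 1 ≤ i → i < n → μ (i + 1) ≤ μ i) ∧
  (∀ i, 1 ≤ i → i ≤ n → μ i + μ (n + 1 - i) = W)

/-- The weight `μ ∈ X⁺₀(n)` corresponds to `(w, l) ∈ L⁺₀(n)`:
`w = μ₁ + μ_n` and `l_i = 2μ_i + n + 1 - w - 2i`. -/
def Corresponds (n : ℕ) (w : ℤ) (l : ℕ → ℤ) (μ : ℕ → ℤ) : Prop :=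
  w = μ 1 + μ n ∧
  ∀ i, 1 ≤ i → i ≤ n → l i = 2 * μ i + (n : ℤ) + 1 - w - 2 * (i : ℤ)

theorem param_gap {n : ℕ} {w : ℤ} {l : ℕ → ℤ} (hl : IsLanglandsParam n w l)
    (i d : ℕ) (hi : 1 ≤ i) (hd : i + d ≤ n) : l (i + d) + 2 * (d : ℤ) ≤ l i := by
  obtain ⟨h1, _, h3⟩ := hl
  induction d with
  | zero => simp
  | succ d ih =>
    have e := ih (by omega)
    have e1 := h1 (i + d) (by omega) (by omega)
    have e2 := h3 (i + d) (by omega) (by omega)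
    have e3 := h3 (i + d + 1) (by omega) (by omega)
    rw [← add_assoc]
    push_cast
    omega

theorem param_gap' {n : ℕ} {w : ℤ} {l : ℕ → ℤ} (hl : IsLanglandsParam n w l)
    (i k : ℕ) (hi : 1 ≤ i) (hik : i ≤ k) (hk : k ≤ n) :
    l k + 2 * ((k : ℤ) - i) ≤ l i := by
  obtain ⟨d, rfl⟩ := Nat.exists_eq_add_of_le hik
  have := param_gap hl i d hi hk
  push_cast
  linarith

theorem param_lt {n : ℕ} {w : ℤ} {l : ℕ → ℤ} (hl : IsLanglandsParam n w l)
    (i k : ℕ) (hi : 1 ≤ i) (hin : i ≤ n) (hk : 1 ≤ k) (h : l k < l i) : i < k := by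
  by_contra hc
  have := param_gap' hl k i hk (by omega) hin
  omega

theorem param_zero {n : ℕ} {w : ℤ} {l : ℕ → ℤ} (hl : IsLanglandsParam n w l)
    (i : ℕ) (hi : 1 ≤ i) (hin : i ≤ n) (h : l i = 0) : 2 * i = n + 1 := by
  have h2 := hl.2.1 i hi hin
  rcases Nat.lt_trichotomy i (n + 1 - i) with h' | h' | h'
  · have := param_gap' hl i (n + 1 - i) hi h'.le (by omega)
    omega
  · omega
  · have := param_gap' hl (n + 1 - i) i (by omega) h'.le (by omega)
    omega

theorem lambda_dominant_and_pure
    (n m : ℕ) (hn : 1 ≤ n) (hm : 1 ≤ m)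
    (w w' : ℤ) (l l' : ℕ → ℤ) (μ ν : ℕ → ℤ)
    (hl : IsLanglandsParam n w l) (hl' : IsLanglandsParam m w' l')
    (hμ : IsDominantPure n μ w) (hν : IsDominantPure m ν w')
    (hcorr : Corresponds n w l μ) (hcorr' : Corresponds m w' l' ν)
    (hfirst : l' 1 < l 1)
    (halt : ∀ i ∈ Finset.Icc 1 n, ∀ j ∈ Finset.Icc 1 m,
      l i ≠ l' j ∨ (l i = 0 ∧ l' j = 0))
    (a : ℕ → ℕ) (ha : IsPositionTuple n m l l' a)
    (lam : ℕ → ℤ) (hlam : ∀ j, lam j = ν j + (a j : ℤ) - (j : ℤ)) :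
    -- `λ` is dominant
    (∀ j, 1 ≤ j → j < m → lam (j + 1) ≤ lam j) ∧
    -- purity `(P_j)` for `j ≠ (m+1)/2`
    (∀ j, 1 ≤ j → j ≤ m → 2 * j ≠ m + 1 →
      lam j + lam (m + 1 - j) = w' + (n : ℤ) - m - 1) ∧
    -- in the non-exceptional case, purity holds for all `j`
    (¬(Odd n ∧ Odd m) → ∀ j, 1 ≤ j → j ≤ m →
      lam j + lam (m + 1 - j) = w' + (n : ℤ) - m - 1) ∧
    -- in the exceptional case, the middle component satisfies
    (Odd n → Odd m → 2 * lam ((m + 1) / 2) = w' + (n : ℤ) - m - 2) := by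
  have key : ∀ j, 1 ≤ j → j ≤ m → l (1 + a j) ≠ l' j →
      lam j + lam (m + 1 - j) = w' + (n : ℤ) - m - 1 := by
    intro j h1 h2 hne
    obtain ⟨p1, p2, p3, p4⟩ := ha j h1 h2
    obtain ⟨q1, q2, q3, q4⟩ := ha (m + 1 - j) (by omega) (by omega)
    have s := hl'.2.1 j h1 h2
    have s1 := hl.2.1 (a j) p1 (by omega)
    have s2 := hl.2.1 (1 + a j) (by omega) (by omega)
    have t1 := param_lt hl (a (m + 1 - j)) (n + 1 - (1 + a j) + 1) q1 (by omega) (by omega) (by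
      rw [show n + 1 - (1 + a j) + 1 = n + 1 - a j by omega]
      omega)
    have t2 := param_lt hl (n + 1 - (1 + a j)) (1 + a (m + 1 - j)) (by omega) (by omega)
      (by omega) (by omega)
    have v := hν.2 j h1 h2
    rw [hlam, hlam]
    omega
  have key2 : ∀ j, 1 ≤ j → j ≤ m → l (1 + a j) = l' j →
      2 * j = m + 1 ∧ 2 * (1 + a j) = n + 1 := by
    intro j h1 h2 he
    obtain ⟨p1, p2, p3, p4⟩ := ha j h1 h2
    have := halt (1 + a j) (Finset.mem_Icc.2 ⟨by omega, by omega⟩) j (Finset.mem_Icc.2 ⟨h1, h2⟩)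
    exact ⟨param_zero hl' j h1 h2 (by omega), param_zero hl (1 + a j) (by omega) (by omega) (by omega)⟩
  refine ⟨?_, ?_, ?_, ?_⟩
  · intro j h1 h2
    obtain ⟨p1, p2, p3, p4⟩ := ha j h1 h2.le
    obtain ⟨q1, q2, q3, q4⟩ := ha (j + 1) (by omega) h2
    have c1 := hcorr'.2 j h1 h2.le
    have c2 := hcorr'.2 (j + 1) (by omega) h2
    have v := hν.1 j h1 h2
    rw [hlam, hlam]
    push_cast at *
    by_cases hc : a (j + 1) ≤ a j
    · omega
    · have g := param_gap' hl (1 + a j) (a (j + 1)) (by omega) (by omega) (by omega)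
      push_cast at g
      omega
  · intro j h1 h2 h3
    exact key j h1 h2 fun he => h3 (key2 j h1 h2 he).1
  · intro ho j h1 h2
    refine key j h1 h2 fun he => ho ?_
    have := key2 j h1 h2 he
    rw [Nat.odd_iff, Nat.odd_iff]
    omega
  · rintro ⟨x, hx⟩ ⟨y, hy⟩
    have ej : (m + 1) / 2 = y + 1 := by omega
    rw [ej]
    obtain ⟨p1, p2, p3, p4⟩ := ha (y + 1) (by omega) (by omega)
    have s := hl'.2.1 (y + 1) (by omega) (by omega)
    rw [show m + 1 - (y + 1) = y + 1 by omega] at s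
    have t := hl.2.1 (x + 1) (by omega) (by omega)
    rw [show n + 1 - (x + 1) = x + 1 by omega] at t
    have v := hν.2 (y + 1) (by omega) (by omega)
    rw [show m + 1 - (y + 1) = y + 1 by omega] at v
    have t1 := param_lt hl (a (y + 1)) (x + 1) p1 (by omega) (by omega) (by omega)
    have t2 : x + 1 ≤ 1 + a (y + 1) := by
      by_contra hc
      have := param_gap' hl (1 + a (y + 1)) (x + 1) (by omega) (by omega) (by omega)
      push_cast at this
      omega
    rw [hlam]
    push_cast
    omega
end

section
/- Let μ ∈ X⁺₀(n) and ν ∈ X⁺₀(m) correspond to Langlands parameters (w,l) ∈ L⁺₀(n) and (w',l') ∈ L⁺₀(m), assume l₁ > l'₁ and that for every pair (i,j) either l_i ≠ l'_j or l_i = l'_j = 0, let a be the position tuple and λ_j := ν_j + a_j − j. Then: (i) in the non-exceptional case (n, m not both odd) λ ∈ X⁺₀(m); (ii) in the exceptional case n ≡ m ≡ 1 (mod 2) with m > 1, the modified weight λ_mod := (λ₁,…,λ_{(m+1)/2}, λ_{(m+3)/2} − 1, …, λ_m − 1) belongs to X⁺₀(m) and the truncated weight λ_tr := (λ₁,…,λ_{(m−1)/2},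 λ_{(m+3)/2},…,λ_m) belongs to X⁺₀(m−1); (iii) for m = 1 one always has λ ∈ X⁺₀(1). -/
/-- `μ ∈ X⁺₀(n)`: dominant admitting some purity weight. -/
def MemX0 (n : ℕ) (μ : ℕ → ℤ) : Prop := ∃ W : ℤ, IsDominantPure n μ W

theorem gap_aux (n : ℕ) (w : ℤ) (l μ : ℕ → ℤ) (hμ : IsDominantPure n μ w)
    (hc : Corresponds n w l μ) (p : ℕ) (hp : 1 ≤ p) (d : ℕ) (h : p + d ≤ n) :
    l (p + d) + 2 * (d : ℤ) ≤ l p := by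
  induction d with
  | zero => simp
  | succ d ih =>
    have h1 := ih (by omega)
    have h2 := hμ.1 (p + d) (by omega) (by omega)
    have h3 := hc.2 (p + d) (by omega) (by omega)
    have h4 := hc.2 (p + d + 1) (by omega) (by omega)
    rw [← add_assoc]
    push_cast at *
    linarith

theorem gap_aux2 (n : ℕ) (w : ℤ) (l μ : ℕ → ℤ) (hμ : IsDominantPure n μ w)
    (hc : Corresponds n w l μ) (p q : ℕ) (hp : 1 ≤ p) (hpq : p ≤ q) (h : q ≤ n) :
    l q + 2 * ((q : ℤ) - p) ≤ l p := by
  obtain ⟨d, rfl⟩ := Nat.exists_eq_add_of_le hpq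
  have := gap_aux n w l μ hμ hc p hp d h
  push_cast
  linarith

theorem mid_aux (n : ℕ) (w : ℤ) (l μ : ℕ → ℤ) (hl : IsLanglandsParam n w l)
    (hμ : IsDominantPure n μ w)
    (hc : Corresponds n w l μ) (p : ℕ) (hp : 1 ≤ p) (h : p ≤ n) (h0 : l p = 0) :
    2 * p = n + 1 := by
  have h1 := hl.2.1 p hp h
  rcases le_total p (n + 1 - p) with h2 | h2
  · have := gap_aux2 n w l μ hμ hc p (n + 1 - p) hp h2 (by omega)
    omega
  · have := gap_aux2 n w l μ hμ hc (n + 1 - p) p (by omega) h2 (by omega)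
    omega

theorem lambda_modifications_in_X0
    (n m : ℕ) (hn : 1 ≤ n) (hm : 1 ≤ m)
    (w w' : ℤ) (l l' : ℕ → ℤ) (μ ν : ℕ → ℤ)
    (hl : IsLanglandsParam n w l) (hl' : IsLanglandsParam m w' l')
    (hμ : IsDominantPure n μ w) (hν : IsDominantPure m ν w')
    (hcorr : Corresponds n w l μ) (hcorr' : Corresponds m w' l' ν)
    (hfirst : l' 1 < l 1)
    (halt : ∀ i ∈ Finset.Icc 1 n, ∀ j ∈ Finset.Icc 1 m,
      l i ≠ l' j ∨ (l i = 0 ∧ l' j = 0))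
    (a : ℕ → ℕ) (ha : IsPositionTuple n m l l' a)
    (lam : ℕ → ℤ) (hlam : ∀ j, lam j = ν j + (a j : ℤ) - (j : ℤ)) :
    -- (i) non-exceptional case: `λ ∈ X⁺₀(m)`
    (¬(Odd n ∧ Odd m) → MemX0 m lam) ∧
    -- (ii) exceptional case: `λ_mod ∈ X⁺₀(m)` and `λ_tr ∈ X⁺₀(m-1)`
    (Odd n → Odd m → 1 < m →
      MemX0 m (fun j => if j ≤ (m + 1) / 2 then lam j else lam j - 1) ∧
      MemX0 (m - 1) (fun j => if j ≤ (m - 1) / 2 then lam j else lam (j + 1))) ∧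
    -- (iii) `m = 1`: always `λ ∈ X⁺₀(1)`
    (m = 1 → MemX0 1 lam) := by
  have G := gap_aux2 n w l μ hμ hcorr
  have M := mid_aux n w l μ hl hμ hcorr
  have M' := mid_aux m w' l' ν hl' hν hcorr'
  have dom : ∀ j, 1 ≤ j → j < m → lam (j + 1) ≤ lam j := by
    intro j h1 h2
    obtain ⟨a1, a2, a3, a4⟩ := ha j h1 h2.le
    obtain ⟨b1, b2, b3, b4⟩ := ha (j + 1) (by omega) h2
    have c1 := hcorr'.2 j h1 h2.le
    have c2 := hcorr'.2 (j + 1) (by omega) h2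
    have c3 := hν.1 j h1 h2
    rw [hlam, hlam]
    push_cast at *
    by_cases hab : 1 + a j ≤ a (j + 1)
    · have := G (1 + a j) (a (j + 1)) (by omega) hab (by omega)
      push_cast at this
      omega
    · omega
  have key : ∀ j, 1 ≤ j → j ≤ m →
      (a j + a (m + 1 - j) = n) ∨ (2 * j = m + 1 ∧ 2 * (1 + a j) = n + 1) := by
    intro j h1 h2
    obtain ⟨a1, a2, a3, a4⟩ := ha j h1 h2
    obtain ⟨b1, b2, b3, b4⟩ := ha (m + 1 - j) (by omega) (by omega)
    by_cases he : l (1 + a j) = l' j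
    · right
      rcases halt (1 + a j) (by simp; omega) j (by simp; omega) with h | ⟨h, h'⟩
      · exact absurd he h
      · exact ⟨M' j h1 h2 h', M _ (by omega) (by omega) h⟩
    · left
      have e1 := hl'.2.1 j h1 h2
      have e2 := hl.2.1 (a j) a1 (by omega)
      have e3 := hl.2.1 (1 + a j) (by omega) (by omega)
      rw [show n + 1 - (1 + a j) = n - a j by omega] at e3
      by_contra hne
      rcases lt_or_gt_of_ne hne with h | h
      · have := G (1 + a (m + 1 - j)) (n - a j) (by omega) (by omega) (by omega)
        omega
      · have := G (n + 1 - a j) (a (m + 1 - j)) (by omega) (by omega) (by omega)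
        omega
  have pur : ∀ j, 1 ≤ j → j ≤ m → a j + a (m + 1 - j) = n →
      lam j + lam (m + 1 - j) = w' + n - (m + 1) := by
    intro j h1 h2 h3
    have := hν.2 j h1 h2
    rw [hlam, hlam]
    omega
  refine ⟨?_, ?_, ?_⟩
  · intro hno
    refine ⟨w' + n - (m + 1), dom, fun j h1 h2 => pur j h1 h2 ?_⟩
    rcases key j h1 h2 with h | ⟨h, h'⟩
    · exact h
    · exact absurd ⟨⟨a j, by omega⟩, ⟨j - 1, by omega⟩⟩ hno
  · rintro ⟨k, hk⟩ ⟨r, hr⟩ hm1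
    have e1 : (m + 1) / 2 = r + 1 := by omega
    have e2 : (m - 1) / 2 = r := by omega
    have pur2 : ∀ j, 1 ≤ j → j ≤ m → 2 * j ≠ m + 1 →
        lam j + lam (m + 1 - j) = w' + n - (m + 1) := by
      intro j h1 h2 h3
      refine pur j h1 h2 ?_
      rcases key j h1 h2 with h | ⟨h, h'⟩
      · exact h
      · exact absurd h h3
    have purm : lam (r + 1) + lam (r + 1) = w' + n - 1 - (m + 1) := by
      have h0 := hν.2 (r + 1) (by omega) (by omega)
      have h := key (r + 1) (by omega) (by omega)
      rw [show m + 1 - (r + 1) = r + 1 by omega] at h h0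
      rw [hlam]
      push_cast
      omega
    rw [e1, e2]
    refine ⟨⟨w' + n - 1 - (m + 1), ?_, ?_⟩, ⟨w' + n - (m + 1), ?_, ?_⟩⟩
    · intro j h1 h2
      have := dom j h1 h2
      dsimp only
      split_ifs <;> omega
    · intro j h1 h2
      dsimp only
      rcases lt_trichotomy j (r + 1) with h | h | h
      · have := pur2 j h1 h2 (by omega)
        rw [if_pos (by omega), if_neg (by omega)]
        omega
      · subst h
        rw [show m + 1 - (r + 1) = r + 1 by omega, if_pos le_rfl]
        exact purm
      · have := pur2 j h1 h2 (by omega)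
        rw [if_neg (by omega), if_pos (by omega)]
        omega
    · intro j h1 h2
      have d1 := dom j h1 (by omega)
      have d2 := dom (j + 1) (by omega) (by omega)
      dsimp only
      split_ifs <;> omega
    · intro j h1 h2
      dsimp only
      by_cases h : j ≤ r
      · have := pur2 j h1 (by omega) (by omega)
        rw [if_pos h, if_neg (by omega), show m - 1 + 1 - j + 1 = m + 1 - j by omega]
        exact this
      · have := pur2 (j + 1) (by omega) (by omega) (by omega)
        rw [if_neg h, if_pos (by omega), show m - 1 + 1 - j = m + 1 - (j + 1) by omega]
        exact this
  · rintro rfl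
    refine ⟨lam 1 + lam 1, fun i _ _ => by omega, fun i h1 h2 => ?_⟩
    obtain rfl : i = 1 := by omega
    rfl
end

section
/- Assume n and m are not both odd, let μ ∈ X⁺₀(n) and ν ∈ X⁺₀(m) correspond to (w,l) ∈ L⁺₀(n) and (w',l') ∈ L⁺₀(m) with l₁ > l'₁ and l_i ≠ l'_j for all pairs (i,j), let a be the position tuple and λ_j := ν_j + a_j − j, and set κ := (w+w'+1)/2 and L := (1/2)·min{|l_i − l'_j| : 1 ≤ i ≤ n, 1 ≤ j ≤ m}. Then a number t ∈ (m+n)/2 + ℤ satisfies |t − κ| < L + 1/2 (i.e. is a critical number) if and only if the integer s := t + (n−m)/2 − 1 satisfies the simultaneous inequalities μ̌_{a_j} ≥ λ_j − s ≥ μ̌_{1+a_j} for j = 1,…,m, where μ̌_i := −μ_{n+1−i}. -/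
theorem critical_iff_inequalities_nonexceptional
    (n m : ℕ) (hn : 1 ≤ n) (hm : 1 ≤ m) (hnm : ¬(Odd n ∧ Odd m))
    (w w' : ℤ) (l l' : ℕ → ℤ) (μ ν : ℕ → ℤ)
    (hl : IsLanglandsParam n w l) (hl' : IsLanglandsParam m w' l')
    (hμ : IsDominantPure n μ w) (hν : IsDominantPure m ν w')
    (hcorr : Corresponds n w l μ) (hcorr' : Corresponds m w' l' ν)
    (hfirst : l' 1 < l 1)
    (hdisj : ∀ i ∈ Finset.Icc 1 n, ∀ j ∈ Finset.Icc 1 m, l i ≠ l' j)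
    (a : ℕ → ℕ) (ha : IsPositionTuple n m l l' a)
    (lam : ℕ → ℤ) (hlam : ∀ j, lam j = ν j + (a j : ℤ) - (j : ℤ))
    (μd : ℕ → ℤ) (hμd : ∀ i, μd i = - μ (n + 1 - i))
    (κ L : ℚ) (hκ : κ = ((w : ℚ) + w' + 1) / 2)
    -- `L` is half the minimum of `|l_i - l'_j|` over all `1 ≤ i ≤ n`, `1 ≤ j ≤ m`:
    (hLlb : ∀ i ∈ Finset.Icc 1 n, ∀ j ∈ Finset.Icc 1 m, L ≤ (|l i - l' j| : ℚ) / 2)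
    (hLmem : ∃ i ∈ Finset.Icc 1 n, ∃ j ∈ Finset.Icc 1 m, L = (|l i - l' j| : ℚ) / 2)
    (t : ℚ) (ht : ∃ z : ℤ, t = ((m : ℚ) + n) / 2 + z)
    (s : ℤ) (hs : (s : ℚ) = t + ((n : ℚ) - m) / 2 - 1) :
    |t - κ| < L + 1 / 2 ↔
      ∀ j, 1 ≤ j → j ≤ m →
        lam j - s ≤ μd (a j) ∧ μd (1 + a j) ≤ lam j - s := by
  obtain ⟨hl1, hl2, hl3⟩ := hl
  obtain ⟨hl1', hl2', hl3'⟩ := hl'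
  obtain ⟨hμ1, hμ2⟩ := hμ
  obtain ⟨hc0, hc⟩ := hcorr
  obtain ⟨hc0', hc'⟩ := hcorr'
  -- monotonicity
  have hmono : ∀ k i, 1 ≤ i → i + k ≤ n → l (i + k) ≤ l i := by
    intro k
    induction k with
    | zero => intro i _ _; simp
    | succ k ih =>
      intro i h1 h2
      have e1 := ih i h1 (by omega)
      have e2 := hl1 (i + k) (by omega) (by omega)
      have e3 : i + (k + 1) = i + k + 1 := by omega
      rw [e3]
      omega
  have hanti : ∀ i i', 1 ≤ i → i ≤ i' → i' ≤ n → l i' ≤ l i := by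
    intro i i' h1 h2 h3
    have e := hmono (i' - i) i h1 (by omega)
    have e3 : i + (i' - i) = i' := by omega
    rwa [e3] at e
  obtain ⟨D, hD⟩ : ∃ D : ℤ, D = 2 * s - n + m + 2 - w - w' - 1 := ⟨_, rfl⟩
  have hDt : t - κ = (D : ℚ) / 2 := by
    rw [hD, hκ]; push_cast; rw [hs]; ring
  have habs : ∀ i j, (|(l i : ℚ) - (l' j : ℚ)|) = ((|l i - l' j| : ℤ) : ℚ) := by
    intro i j; push_cast; rfl
  have hrhs : ∀ j, 1 ≤ j → j ≤ m →
      ((lam j - s ≤ μd (a j) ∧ μd (1 + a j) ≤ lam j - s) ↔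
        (1 - D ≤ l (a j) - l' j ∧ D + 1 ≤ l' j - l (1 + a j))) := by
    intro j h1 h2
    obtain ⟨p1, p2, p3, p4⟩ := ha j h1 h2
    have q1 := hc (a j) p1 (by omega)
    have q2 := hc (1 + a j) (by omega) (by omega)
    have q3 := hc' j h1 h2
    have q4 := hμ2 (a j) p1 (by omega)
    have q5 := hμ2 (1 + a j) (by omega) (by omega)
    have q6 := hlam j
    have q7 := hμd (a j)
    have q8 := hμd (1 + a j)
    push_cast at q2
    constructor
    · rintro ⟨r1, r2⟩
      constructor <;> linarith
    · rintro ⟨r1, r2⟩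
      constructor <;> linarith
  have hLHS : ∀ x : ℤ, L = (x : ℚ) / 2 → (|t - κ| < L + 1 / 2 ↔ |D| ≤ x) := by
    intro x hx
    rw [hDt, hx, abs_div, abs_two]
    have e : (|(D : ℚ)|) = ((|D| : ℤ) : ℚ) := by push_cast; rfl
    rw [e]
    constructor
    · intro h
      have h2 : ((|D| : ℤ) : ℚ) < ((x + 1 : ℤ) : ℚ) := by push_cast at h ⊢; linarith
      have h3 : |D| < x + 1 := by exact_mod_cast h2
      omega
    · intro h
      have h2 : ((|D| : ℤ) : ℚ) ≤ (x : ℚ) := by exact_mod_cast h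
      linarith
  obtain ⟨i0, hi0, j0, hj0, hL0⟩ := hLmem
  rw [habs] at hL0
  rw [hLHS _ hL0]
  have hmin : ∀ i, 1 ≤ i → i ≤ n → ∀ j, 1 ≤ j → j ≤ m → |l i0 - l' j0| ≤ |l i - l' j| := by
    intro i h1 h2 j h3 h4
    have h := hLlb i (Finset.mem_Icc.2 ⟨h1, h2⟩) j (Finset.mem_Icc.2 ⟨h3, h4⟩)
    rw [habs, hL0] at h
    have h5 : ((|l i0 - l' j0| : ℤ) : ℚ) ≤ ((|l i - l' j| : ℤ) : ℚ) := by linarith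
    exact_mod_cast h5
  constructor
  · intro h j h1 h2
    rw [hrhs j h1 h2]
    obtain ⟨p1, p2, p3, p4⟩ := ha j h1 h2
    have m1 := hmin (a j) p1 (by omega) j h1 h2
    have m2 := hmin (1 + a j) (by omega) (by omega) j h1 h2
    rw [abs_of_pos (by omega : 0 < l (a j) - l' j)] at m1
    rw [abs_of_nonpos (by omega : l (1 + a j) - l' j ≤ 0)] at m2
    have q1 := hl3 (a j) p1 (by omega)
    have q2 := hl3 (1 + a j) (by omega) (by omega)
    have q3 := hl3' j h1 h2
    have b1 := le_abs_self D
    have b2 := neg_abs_le D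
    constructor <;> omega
  · intro h
    have key : ∀ i, 1 ≤ i → i ≤ n → ∀ j, 1 ≤ j → j ≤ m →
        (1 - D ≤ l i - l' j ∨ D + 1 ≤ l' j - l i) ∧ (l' j < l i → 1 - D ≤ l i - l' j) ∧
        (l i < l' j → D + 1 ≤ l' j - l i) := by
      intro i h1 h2 j h3 h4
      obtain ⟨p1, p2, p3, p4⟩ := ha j h3 h4
      obtain ⟨r1, r2⟩ := (hrhs j h3 h4).1 (h j h3 h4)
      rcases Nat.lt_or_ge (a j) i with hi | hi
      · have := hanti (1 + a j) i (by omega) (by omega) h2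
        refine ⟨by omega, by omega, by omega⟩
      · have := hanti i (a j) h1 hi (by omega)
        refine ⟨by omega, by omega, by omega⟩
    have hne := hdisj i0 hi0 j0 hj0
    rw [Finset.mem_Icc] at hi0 hj0
    obtain ⟨-, k1, k2⟩ := key i0 hi0.1 hi0.2 j0 hj0.1 hj0.2
    obtain ⟨-, k3, k4⟩ := key (n + 1 - i0) (by omega) (by omega) (m + 1 - j0) (by omega) (by omega)
    have d1 := hl2 i0 hi0.1 hi0.2
    have d2 := hl2' j0 hj0.1 hj0.2
    rw [abs_le]
    rcases lt_or_gt_of_ne hne with g | g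
    · rw [abs_of_neg (by omega)]
      have := k2 g
      have := k3 (by omega)
      constructor <;> omega
    · rw [abs_of_pos (by omega)]
      have := k1 g
      have := k4 (by omega)
      constructor <;> omega
end

section
/- Let r ≥ 1 be odd, let y ∈ X_sp(2r) and z ∈ X⁺₀(2r). Then the following are equivalent: (a) z_{2ρ−1} ≥ y_{2ρ−1} ≥ y_{2ρ} ≥ z_{2ρ} for all ρ = 1,…,r; (b) θ'₁(y) ≺ θ₁(z) and θ'₂(y) ≺ θ₂(z). -/
/-- `β ≺ α` for `β ∈ ℤ^r`, `α ∈ ℤ^{r+1}`: `α_ρ ≥ β_ρ ≥ α_{ρ+1}` for `ρ = 1, …, r`. -/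
def Prec (r : ℕ) (β α : ℕ → ℤ) : Prop :=
  ∀ ρ, 1 ≤ ρ → ρ ≤ r → β ρ ≤ α ρ ∧ α (ρ + 1) ≤ β ρ

/-- The splitting map `θ₁ : ℤ^{2r} → ℤ^{r+1}`.
For even `r`: `θ₁(y) = (y₁, y₂, y₄, …, y_r, y_{r+3}, y_{r+5}, …, y_{2r-1}, y_{2r})`;
for odd `r`: `θ₁(y) = (y₁, y₂, y₄, …, y_{r-1}, y_{r+2}, y_{r+4}, …, y_{2r-1}, y_{2r})`. -/
def theta1 (r : ℕ) (y : ℕ → ℤ) : ℕ → ℤ := fun ρ =>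
  if ρ = 1 then y 1
  else if ρ = r + 1 then y (2 * r)
  else if r % 2 = 0 then
    (if ρ ≤ r / 2 + 1 then y (2 * ρ - 2) else y (2 * ρ - r - 1))
  else
    (if ρ ≤ (r + 1) / 2 then y (2 * ρ - 2) else y (2 * ρ - 1))

/-- The splitting map `θ₂ : ℤ^{2r} → ℤ^{r+1}`.
For even `r`: `θ₂(y) = (y₁, y₃, …, y_{r-1}, y_{r+1}, y_{r+2}, y_{r+4}, …, y_{2r})`;
for odd `r`: `θ₂(y) = (y₁, y₃, …, y_r, y_{r+1}, y_{r+3}, …, y_{2r})`. -/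
def theta2 (r : ℕ) (y : ℕ → ℤ) : ℕ → ℤ := fun ρ =>
  if r % 2 = 0 then
    (if ρ ≤ r / 2 then y (2 * ρ - 1)
     else if ρ = r / 2 + 1 then y (r + 1)
     else y (2 * ρ - 2))
  else
    (if ρ ≤ (r + 1) / 2 then y (2 * ρ - 1) else y (2 * ρ - 2))

/-- The splitting map `θ'₁ : ℤ^{2r} → ℤ^r`.
For even `r`: `θ'₁(z) = (z₂, z₄, …, z_r, z_{r+1}, z_{r+3}, …, z_{2r-1})`;
for odd `r > 1`: `θ'₁(z) = (z₂, z₄, …, z_{r+1}, z_{r+2}, z_{r+4}, …, z_{2r-1})`;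
for `r = 1`: `θ'₁(z) = (z₁)`. -/
def theta1' (r : ℕ) (z : ℕ → ℤ) : ℕ → ℤ := fun ρ =>
  if r = 1 then z 1
  else if ρ ≤ (r + 1) / 2 then z (2 * ρ)
  else z (2 * ρ - 1)

/-- The splitting map `θ'₂ : ℤ^{2r} → ℤ^r`.
For even `r`: `θ'₂(z) = (z₁, z₃, …, z_{r-1}, z_{r+2}, z_{r+4}, …, z_{2r})`;
for odd `r`: `θ'₂(z) = (z₁, z₃, …, z_r, z_{r+3}, z_{r+5}, …, z_{2r})`. -/
def theta2' (r : ℕ) (z : ℕ → ℤ) : ℕ → ℤ := fun ρ =>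
  if ρ ≤ (r + 1) / 2 then z (2 * ρ - 1) else z (2 * ρ)

theorem inequalities_iff_embeddings_odd
    (r : ℕ) (hr : 1 ≤ r) (hro : Odd r) (y z : ℕ → ℤ)
    (hy : MemX0 (2 * r) y) (hyd : y r = y (r + 1))  -- `y ∈ X_sp(2r)`
    (hz : MemX0 (2 * r) z) :
    (∀ ρ, 1 ≤ ρ → ρ ≤ r →
      y (2 * ρ - 1) ≤ z (2 * ρ - 1) ∧
      y (2 * ρ) ≤ y (2 * ρ - 1) ∧
      z (2 * ρ) ≤ y (2 * ρ)) ↔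
    (Prec r (theta1' r y) (theta1 r z) ∧ Prec r (theta2' r y) (theta2 r z)) := by
  obtain ⟨k, rfl⟩ := hro
  obtain ⟨_, hy, -⟩ := hy
  obtain ⟨_, hz, -⟩ := hz
  have e1 : (2 * k + 1 + 1) / 2 = k + 1 := by omega
  have e2 : ¬ (2 * k + 1) % 2 = 0 := by omega
  unfold Prec theta1 theta2 theta1' theta2'
  simp only [e1, e2, if_false]
  constructor
  · intro h
    constructor
    · intro ρ h1 h2
      obtain ⟨m, rfl⟩ : ∃ m, ρ = m + 1 := ⟨ρ - 1, by omega⟩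
      have a := h (m + 1) h1 h2
      have b := hz (2 * m)
      have c := hz (2 * m + 1)
      have d := hz (2 * m + 2)
      have f : 2 * (m + 1) - 1 = 2 * m + 1 := by omega
      have f2 : 2 * (m + 1) - 2 = 2 * m := by omega
      have f3 : 2 * (m + 1 + 1) - 1 = 2 * m + 3 := by omega
      have f4 : 2 * (m + 1 + 1) - 2 = 2 * m + 2 := by omega
      have f5 : 2 * (m + 1) = 2 * m + 2 := by omega
      clear h hy hz
      rw [f, f5] at a
      rw [f, f2, f3, f4, f5]
      clear f f2 f3 f4 f5
      obtain ⟨a1, a2, a3⟩ := a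
      have c' := c (by omega) (by omega)
      clear c
      have g : m = 2 * k → 2 * (2 * k + 1) = 2 * m + 2 := by omega
      have hb : m ≠ 0 → z (2 * m + 1) ≤ z (2 * m) := fun h => b (by omega) (by omega)
      have hd : m ≠ 2 * k → z (2 * m + 3) ≤ z (2 * m + 2) := fun h => d (by omega) (by omega)
      clear b d
      have g1 : m = 0 → z (2 * m + 1) = z 1 := by rintro rfl; rfl
      have g2 : m = 0 → y (2 * m + 1) = y 1 := by rintro rfl; rfl
      constructor
      · split_ifs <;> omega
      · split_ifs <;> first | omega | (rw [g (by omega)]; omega)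
    · intro ρ h1 h2
      obtain ⟨m, rfl⟩ : ∃ m, ρ = m + 1 := ⟨ρ - 1, by omega⟩
      have a := h (m + 1) h1 h2
      have b := hz (2 * m)
      have c := hz (2 * m + 1)
      have d := hz (2 * m + 2)
      have f : 2 * (m + 1) - 1 = 2 * m + 1 := by omega
      have f2 : 2 * (m + 1) - 2 = 2 * m := by omega
      have f3 : 2 * (m + 1 + 1) - 1 = 2 * m + 3 := by omega
      have f4 : 2 * (m + 1 + 1) - 2 = 2 * m + 2 := by omega
      have f5 : 2 * (m + 1) = 2 * m + 2 := by omega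
      clear h hy hz
      rw [f, f5] at a
      rw [f, f2, f3, f4, f5]
      clear f f2 f3 f4 f5
      obtain ⟨a1, a2, a3⟩ := a
      have c' := c (by omega) (by omega)
      clear c
      have g : m = 2 * k → 2 * (2 * k + 1) = 2 * m + 2 := by omega
      have hb : m ≠ 0 → z (2 * m + 1) ≤ z (2 * m) := fun h => b (by omega) (by omega)
      have hd : m ≠ 2 * k → z (2 * m + 3) ≤ z (2 * m + 2) := fun h => d (by omega) (by omega)
      clear b d
      constructor
      · split_ifs <;> omega
      · split_ifs <;> omega
  · rintro ⟨h, h'⟩ ρ h1 h2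
    obtain ⟨m, rfl⟩ : ∃ m, ρ = m + 1 := ⟨ρ - 1, by omega⟩
    have a := h (m + 1) h1 h2
    have a' := h' (m + 1) h1 h2
    have c := hy (2 * m + 1) (by omega) (by omega)
    have f : 2 * (m + 1) - 1 = 2 * m + 1 := by omega
    have f2 : 2 * (m + 1) - 2 = 2 * m := by omega
    have f3 : 2 * (m + 1 + 1) - 1 = 2 * m + 3 := by omega
    have f4 : 2 * (m + 1 + 1) - 2 = 2 * m + 2 := by omega
    have f5 : 2 * (m + 1) = 2 * m + 2 := by omega
    clear h h' hy hz
    rw [f, f2, f3, f4, f5] at a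
    rw [f, f2, f3, f4, f5] at a'
    rw [f, f5]
    clear f f2 f3 f4 f5
    rcases lt_trichotomy m k with hm | hm | hm
    · grind
    · subst hm
      grind
    · grind
end
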